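/- Strong Morita equivalence of weak coactions of a finite dimensional C*-Hopf algebra's dual H^0 on unital C*-algebras is an equivalence relation; in particular, if ρ, σ, γ are weak coactions of H^0 on unital C*-algebras A, B, C with ρ strongly Morita equivalent to σ via (X,λ) and σ strongly Morita equivalent to γ via (Y,μ), then the map h·_{λ⊗μ}(x⊗y) = [h_(1)·_λ x]⊗[h_(2)·_μ y] defines a weak coaction of H^0 on the interior tensor product X⊗_B Y implementing a strong Morita equivalence between ρ and γ. -/

import Mathlib

open scoped TensorProduct
open Filter Topology
set_option maxHeartbeats 1000000
set_option linter.unusedSectionVars false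
set_option synthInstance.maxHeartbeats 400000
noncomputable section
namespace SMEPaper
universe u

/-! ### Generalities on tensor products with a finite dimensional C*-algebra -/

/-- Contraction of the right tensor factor against a linear functional:
`appRight f (m ⊗ c) = f c • m`. -/
def appRight {M C : Type*} [AddCommGroup M] [Module ℂ M] [AddCommGroup C] [Module ℂ C]
    (f : C →ₗ[ℂ] ℂ) : M ⊗[ℂ] C →ₗ[ℂ] M :=
  (TensorProduct.rid ℂ M).toLinearMap ∘ₗ TensorProduct.map LinearMap.id f

/-- The `i`-th coordinate, with respect to the canonical finite basis of `C`, of an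
element of `M ⊗[ℂ] C`. -/
def tcoord {M C : Type*} [AddCommGroup M] [Module ℂ M] [AddCommGroup C] [Module ℂ C]
    [FiniteDimensional ℂ C] (i : Fin (Module.finrank ℂ C)) : M ⊗[ℂ] C →ₗ[ℂ] M :=
  appRight ((Module.finBasis ℂ C).coord i)

/-- The star operation on `M ⊗[ℂ] C` (`C` finite dimensional) where the star operation on the
first factor is supplied as a function: on simple tensors, `m ⊗ c ↦ sM m ⊗ star c`. -/
def tstarWith {M C : Type*} [AddCommGroup M] [Module ℂ M] [Ring C] [Algebra ℂ C]
    [StarRing C] [FiniteDimensional ℂ C] (sM : M → M) (t : M ⊗[ℂ] C) : M ⊗[ℂ] C :=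
  ∑ i, sM (tcoord i t) ⊗ₜ star (Module.finBasis ℂ C i)

/-- Combination of an operation on the first factors and an operation on the second (finite
dimensional) factors to an operation on tensor products: on simple tensors,
`tmix op cop (p ⊗ c) (q ⊗ d) = op p q ⊗ cop c d`. -/
def tmix {P Q R C : Type*} [AddCommGroup P] [Module ℂ P] [AddCommGroup Q] [Module ℂ Q]
    [AddCommGroup R] [Module ℂ R] [Ring C] [Algebra ℂ C] [FiniteDimensional ℂ C]
    (op : P → Q → R) (cop : C → C → C) (s : P ⊗[ℂ] C) (t : Q ⊗[ℂ] C) : R ⊗[ℂ] C :=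
  ∑ i, ∑ j,
    op (tcoord i s) (tcoord j t) ⊗ₜ cop (Module.finBasis ℂ C i) (Module.finBasis ℂ C j)

/-- The operation on tensor products induced by an operation on the first factors (and
multiplication in the second): `tact op (p ⊗ c) (q ⊗ d) = op p q ⊗ (c * d)`. -/
def tact {P Q R C : Type*} [AddCommGroup P] [Module ℂ P] [AddCommGroup Q] [Module ℂ Q]
    [AddCommGroup R] [Module ℂ R] [Ring C] [Algebra ℂ C] [FiniteDimensional ℂ C]
    (op : P → Q → R) : P ⊗[ℂ] C → Q ⊗[ℂ] C → R ⊗[ℂ] C :=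
  tmix op (· * ·)

/-- The left inner product on `X ⊗ C` induced by a left (`A`-valued) inner product on `X`:
`(x ⊗ c), (y ⊗ d) ↦ inn x y ⊗ (c * star d)`. -/
def tinnL {X A C : Type*} [AddCommGroup X] [Module ℂ X] [AddCommGroup A] [Module ℂ A]
    [Ring C] [Algebra ℂ C] [StarRing C] [FiniteDimensional ℂ C]
    (inn : X → X → A) : X ⊗[ℂ] C → X ⊗[ℂ] C → A ⊗[ℂ] C :=
  tmix inn (fun c d => c * star d)

/-- The right inner product on `X ⊗ C` induced by a right (`B`-valued) inner product on `X`: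
`(x ⊗ c), (y ⊗ d) ↦ inn x y ⊗ (star c * d)`. -/
def tinnR {X B C : Type*} [AddCommGroup X] [Module ℂ X] [AddCommGroup B] [Module ℂ B]
    [Ring C] [Algebra ℂ C] [StarRing C] [FiniteDimensional ℂ C]
    (inn : X → X → B) : X ⊗[ℂ] C → X ⊗[ℂ] C → B ⊗[ℂ] C :=
  tmix inn (fun c d => star c * d)

/-! ### Finite dimensional C*-Hopf algebras -/

/-- The data and axioms of a finite dimensional C*-Hopf algebra structure on the finite
dimensional C*-algebra `H0`: a comultiplication, counit and antipode satisfying the Hopf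
algebra axioms, compatibly with the ⋆-structure. -/
structure HopfAlgData (H0 : Type u) [Ring H0] [Algebra ℂ H0] [StarRing H0]
    [StarModule ℂ H0] [FiniteDimensional ℂ H0] where
  comul : H0 →ₐ[ℂ] H0 ⊗[ℂ] H0
  counit : H0 →ₐ[ℂ] ℂ
  antipode : H0 →ₗ[ℂ] H0
  coassoc : ∀ h, TensorProduct.map comul.toLinearMap LinearMap.id (comul h)
      = (TensorProduct.assoc ℂ H0 H0 H0).symm
          (TensorProduct.map LinearMap.id comul.toLinearMap (comul h))
  counit_left : ∀ h,
      (TensorProduct.lid ℂ H0) (TensorProduct.map counit.toLinearMap LinearMap.id (comul h)) = h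
  counit_right : ∀ h, appRight counit.toLinearMap (comul h) = h
  antipode_left : ∀ (h : H0) (n : ℕ) (h1 h2 : Fin n → H0),
      comul h = ∑ i, h1 i ⊗ₜ h2 i → ∑ i, antipode (h1 i) * h2 i = counit h • 1
  antipode_right : ∀ (h : H0) (n : ℕ) (h1 h2 : Fin n → H0),
      comul h = ∑ i, h1 i ⊗ₜ h2 i → ∑ i, h1 i * antipode (h2 i) = counit h • 1
  comul_star : ∀ h, comul (star h) = tstarWith star (comul h)
  counit_star : ∀ h, counit (star h) = starRingEnd ℂ (counit h)

/-! ### Coactions on C*-algebras -/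

section Coaction
variable {H0 : Type u} [Ring H0] [Algebra ℂ H0] [StarRing H0] [StarModule ℂ H0]
  [FiniteDimensional ℂ H0]
variable {A B X : Type u} [Ring A] [Algebra ℂ A] [StarRing A]
  [Ring B] [Algebra ℂ B] [StarRing B] [AddCommGroup X] [Module ℂ X]

/-- `ρ : A → A ⊗ H0` is a weak coaction of `H0` (with counit `ε0`) on `A`:
a unital ⋆-homomorphism with `(id ⊗ ε0) ∘ ρ = id`. -/
structure IsWeakCoaction (ε0 : H0 →ₗ[ℂ] ℂ) (ρ : A →ₗ[ℂ] A ⊗[ℂ] H0) : Prop where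
  map_one : ρ 1 = 1
  map_mul : ∀ a b, ρ (a * b) = ρ a * ρ b
  map_star : ∀ a, ρ (star a) = tstarWith star (ρ a)
  counital : ∀ a, appRight ε0 (ρ a) = a

/-- `ρ : A → A ⊗ H0` is a coaction of `H0` (with comultiplication `Δ0`, counit `ε0`) on `A`:
a weak coaction with `(ρ ⊗ id) ∘ ρ = (id ⊗ Δ0) ∘ ρ`. -/
structure IsCoaction (Δ0 : H0 →ₗ[ℂ] H0 ⊗[ℂ] H0) (ε0 : H0 →ₗ[ℂ] ℂ)
    (ρ : A →ₗ[ℂ] A ⊗[ℂ] H0) extends IsWeakCoaction ε0 ρ : Prop where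
  coassoc : ∀ a, TensorProduct.map ρ LinearMap.id (ρ a)
      = (TensorProduct.assoc ℂ A H0 H0).symm (TensorProduct.map LinearMap.id Δ0 (ρ a))

/-- The pair `(ρ, u)` is a twisted coaction of `H0` on `A`. -/
structure IsTwistedCoaction (Δ0 : H0 →ₗ[ℂ] H0 ⊗[ℂ] H0) (ε0 : H0 →ₗ[ℂ] ℂ)
    (ρ : A →ₗ[ℂ] A ⊗[ℂ] H0) (u : (A ⊗[ℂ] H0) ⊗[ℂ] H0)
    extends IsWeakCoaction ε0 ρ : Prop where
  unitary_left : u * tstarWith (tstarWith star) u = 1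
  unitary_right : tstarWith (tstarWith star) u * u = 1
  twisted_coassoc : ∀ a, TensorProduct.map ρ LinearMap.id (ρ a)
      = u * ((TensorProduct.assoc ℂ A H0 H0).symm (TensorProduct.map LinearMap.id Δ0 (ρ a)))
        * tstarWith (tstarWith star) u
  cocycle : (u ⊗ₜ (1 : H0))
        * TensorProduct.map ((TensorProduct.assoc ℂ A H0 H0).symm.toLinearMap
            ∘ₗ TensorProduct.map LinearMap.id Δ0) LinearMap.id u
      = TensorProduct.map (TensorProduct.map ρ LinearMap.id) LinearMap.id u
        * (TensorProduct.assoc ℂ (A ⊗[ℂ] H0) H0 H0).symm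
            (TensorProduct.map LinearMap.id Δ0 u)
  counit_mid : ∀ h : Module.Dual ℂ H0, appRight h (appRight ε0 u) = h 1 • (1 : A)
  counit_out : ∀ h : Module.Dual ℂ H0, appRight ε0 (appRight h u) = h 1 • (1 : A)

/-- The trivial coaction `a ↦ a ⊗ 1` of `H0` on `A`. -/
def trivialCoaction (H0 : Type u) [Ring H0] [Algebra ℂ H0] (A : Type u) [Ring A]
    [Algebra ℂ A] : A →ₗ[ℂ] A ⊗[ℂ] H0 :=
  (TensorProduct.mk ℂ A H0).flip 1

end Coaction

/-! ### Hilbert bimodules -/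

/-- A (pre-)Hilbert `A`–`B` bimodule structure on `X`: a bimodule with a left `A`-valued and a
right `B`-valued inner product, compatible with the module actions, with the appropriate
(conjugate-)linearity, symmetry, positivity and definiteness properties. -/
structure Bimod (A B X : Type u) [Ring A] [Algebra ℂ A] [StarRing A]
    [Ring B] [Algebra ℂ B] [StarRing B] [AddCommGroup X] [Module ℂ X] where
  ls : A → X → X
  rs : X → B → X
  linn : X → X → A
  rinn : X → X → B
  ls_one : ∀ x, ls 1 x = x
  ls_mul : ∀ a a' x, ls (a * a') x = ls a (ls a' x)
  ls_add : ∀ a a' x, ls (a + a') x = ls a x + ls a' x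
  ls_add' : ∀ a x y, ls a (x + y) = ls a x + ls a y
  ls_smul : ∀ (c : ℂ) a x, ls (c • a) x = c • ls a x
  ls_smul' : ∀ (c : ℂ) a x, ls a (c • x) = c • ls a x
  rs_one : ∀ x, rs x 1 = x
  rs_mul : ∀ x b b', rs x (b * b') = rs (rs x b) b'
  rs_add : ∀ x b b', rs x (b + b') = rs x b + rs x b'
  rs_add' : ∀ x y b, rs (x + y) b = rs x b + rs y b
  rs_smul : ∀ (c : ℂ) x b, rs x (c • b) = c • rs x b
  rs_smul' : ∀ (c : ℂ) x b, rs (c • x) b = c • rs x b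
  ls_rs : ∀ a x b, ls a (rs x b) = rs (ls a x) b
  linn_add_left : ∀ x y z, linn (x + y) z = linn x z + linn y z
  linn_add_right : ∀ x y z, linn x (y + z) = linn x y + linn x z
  rinn_add_left : ∀ x y z, rinn (x + y) z = rinn x z + rinn y z
  rinn_add_right : ∀ x y z, rinn x (y + z) = rinn x y + rinn x z
  linn_smul_left : ∀ (c : ℂ) x y, linn (c • x) y = c • linn x y
  linn_smul_right : ∀ (c : ℂ) x y, linn x (c • y) = starRingEnd ℂ c • linn x y
  rinn_smul_left : ∀ (c : ℂ) x y, rinn (c • x) y = starRingEnd ℂ c • rinn x y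
  rinn_smul_right : ∀ (c : ℂ) x y, rinn x (c • y) = c • rinn x y
  linn_star : ∀ x y, star (linn x y) = linn y x
  rinn_star : ∀ x y, star (rinn x y) = rinn y x
  linn_ls : ∀ a x y, linn (ls a x) y = a * linn x y
  rinn_rs : ∀ x y b, rinn x (rs y b) = rinn x y * b
  linn_rs : ∀ x y b, linn (rs x b) y = linn x (rs y (star b))
  rinn_ls : ∀ a x y, rinn (ls a x) y = rinn x (ls (star a) y)
  linn_pos : ∀ x, ∃ a, linn x x = star a * a
  rinn_pos : ∀ x, ∃ b, rinn x x = star b * b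
  rinn_def : ∀ x, rinn x x = 0 → x = 0

section BimodDefs
variable {A B X : Type u} [Ring A] [Algebra ℂ A] [StarRing A]
    [Ring B] [Algebra ℂ B] [StarRing B] [AddCommGroup X] [Module ℂ X]

/-- A Hilbert bimodule is of finite type if it admits a finite right basis and a finite left
basis in the sense of Kajiwara–Watatani. -/
def Bimod.FiniteType (bm : Bimod A B X) : Prop :=
  (∃ (n : ℕ) (u : Fin n → X), ∀ x, ∑ i, bm.rs (u i) (bm.rinn (u i) x) = x) ∧
  (∃ (m : ℕ) (v : Fin m → X), ∀ x, ∑ j, bm.ls (bm.linn x (v j)) (v j) = x)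

/-- An equivalence bimodule: both inner products are full and the associativity condition
`_A⟨x,y⟩ • z = x • ⟨y,z⟩_B` holds. -/
def Bimod.IsEquivalence (bm : Bimod A B X) : Prop :=
  (∀ x y z, bm.ls (bm.linn x y) z = bm.rs x (bm.rinn y z)) ∧
  Submodule.span ℂ (Set.range fun p : X × X => bm.linn p.1 p.2) = ⊤ ∧
  Submodule.span ℂ (Set.range fun p : X × X => bm.rinn p.1 p.2) = ⊤

end BimodDefs

/-! ### Coactions on Hilbert bimodules, covariant systems, strong Morita equivalence -/

section BimodCoaction
variable {H0 : Type u} [Ring H0] [Algebra ℂ H0] [StarRing H0] [StarModule ℂ H0]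
  [FiniteDimensional ℂ H0]
variable {A B X : Type u} [Ring A] [Algebra ℂ A] [StarRing A]
  [Ring B] [Algebra ℂ B] [StarRing B] [AddCommGroup X] [Module ℂ X]

/-- `(A, B, X, ρ, σ, λ, H0)` is a weak covariant system: `lam` is a weak coaction of `H0` on
the Hilbert `A`–`B` bimodule `X` with respect to `(A, B, ρ, σ)`. -/
structure IsWeakCoactionBimod (ε0 : H0 →ₗ[ℂ] ℂ) (bm : Bimod A B X)
    (ρ : A →ₗ[ℂ] A ⊗[ℂ] H0) (σ : B →ₗ[ℂ] B ⊗[ℂ] H0)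
    (lam : X →ₗ[ℂ] X ⊗[ℂ] H0) : Prop where
  ls_compat : ∀ a x, lam (bm.ls a x) = tact bm.ls (ρ a) (lam x)
  rs_compat : ∀ x b, lam (bm.rs x b) = tact bm.rs (lam x) (σ b)
  linn_compat : ∀ x y, ρ (bm.linn x y) = tinnL bm.linn (lam x) (lam y)
  rinn_compat : ∀ x y, σ (bm.rinn x y) = tinnR bm.rinn (lam x) (lam y)
  counital : ∀ x, appRight ε0 (lam x) = x

/-- `(A, B, X, ρ, σ, λ, H0)` is a covariant system: `lam` is a coaction of `H0` on the
Hilbert `A`–`B` bimodule `X` with respect to `(A, B, ρ, σ)`. -/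
structure IsCoactionBimod (Δ0 : H0 →ₗ[ℂ] H0 ⊗[ℂ] H0) (ε0 : H0 →ₗ[ℂ] ℂ) (bm : Bimod A B X)
    (ρ : A →ₗ[ℂ] A ⊗[ℂ] H0) (σ : B →ₗ[ℂ] B ⊗[ℂ] H0) (lam : X →ₗ[ℂ] X ⊗[ℂ] H0)
    extends IsWeakCoactionBimod ε0 bm ρ σ lam : Prop where
  coassoc : ∀ x, TensorProduct.map lam LinearMap.id (lam x)
      = (TensorProduct.assoc ℂ X H0 H0).symm (TensorProduct.map LinearMap.id Δ0 (lam x))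

/-- `(A, B, X, ρ, u, σ, v, λ, H0)` is a twisted covariant system: `lam` is a twisted coaction
of `H0` on the Hilbert `A`–`B` bimodule `X` with respect to `(A, B, ρ, u, σ, v)`. -/
structure IsTwistedCoactionBimod (Δ0 : H0 →ₗ[ℂ] H0 ⊗[ℂ] H0) (ε0 : H0 →ₗ[ℂ] ℂ)
    (bm : Bimod A B X) (ρ : A →ₗ[ℂ] A ⊗[ℂ] H0) (u : (A ⊗[ℂ] H0) ⊗[ℂ] H0)
    (σ : B →ₗ[ℂ] B ⊗[ℂ] H0) (v : (B ⊗[ℂ] H0) ⊗[ℂ] H0) (lam : X →ₗ[ℂ] X ⊗[ℂ] H0)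
    extends IsWeakCoactionBimod ε0 bm ρ σ lam : Prop where
  twisted : ∀ x, TensorProduct.map lam LinearMap.id (lam x)
      = tact (tact bm.rs)
          (tact (tact bm.ls) u
            ((TensorProduct.assoc ℂ X H0 H0).symm (TensorProduct.map LinearMap.id Δ0 (lam x))))
          (tstarWith (tstarWith star) v)

/-- Two weak coactions `ρ` (on `A`) and `σ` (on `B`) of `H0` are strongly Morita equivalent
if there are an `A`–`B` equivalence bimodule `X` and a weak coaction of `H0` on `X` with
respect to `(A, B, ρ, σ)`. -/
def WeakSME (ε0 : H0 →ₗ[ℂ] ℂ) (ρ : A →ₗ[ℂ] A ⊗[ℂ] H0) (σ : B →ₗ[ℂ] B ⊗[ℂ] H0) : Prop :=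
  ∃ (X : Type u) (_ : AddCommGroup X) (_ : Module ℂ X) (bm : Bimod A B X),
    bm.IsEquivalence ∧ ∃ lam : X →ₗ[ℂ] X ⊗[ℂ] H0, IsWeakCoactionBimod ε0 bm ρ σ lam

/-- Two coactions `ρ` (on `A`) and `σ` (on `B`) of `H0` are strongly Morita equivalent if
there are an `A`–`B` equivalence bimodule `X` and a coaction of `H0` on `X` with respect to
`(A, B, ρ, σ)`. -/
def CoactSME (Δ0 : H0 →ₗ[ℂ] H0 ⊗[ℂ] H0) (ε0 : H0 →ₗ[ℂ] ℂ)
    (ρ : A →ₗ[ℂ] A ⊗[ℂ] H0) (σ : B →ₗ[ℂ] B ⊗[ℂ] H0) : Prop :=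
  ∃ (X : Type u) (_ : AddCommGroup X) (_ : Module ℂ X) (bm : Bimod A B X),
    bm.IsEquivalence ∧ ∃ lam : X →ₗ[ℂ] X ⊗[ℂ] H0, IsCoactionBimod Δ0 ε0 bm ρ σ lam

/-- Two twisted coactions `(ρ, u)` (on `A`) and `(σ, v)` (on `B`) of `H0` are strongly Morita
equivalent if there are an `A`–`B` equivalence bimodule `X` and a twisted coaction of `H0` on
`X` with respect to `(A, B, ρ, u, σ, v)`. -/
def TwistedSME (Δ0 : H0 →ₗ[ℂ] H0 ⊗[ℂ] H0) (ε0 : H0 →ₗ[ℂ] ℂ)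
    (ρ : A →ₗ[ℂ] A ⊗[ℂ] H0) (u : (A ⊗[ℂ] H0) ⊗[ℂ] H0)
    (σ : B →ₗ[ℂ] B ⊗[ℂ] H0) (v : (B ⊗[ℂ] H0) ⊗[ℂ] H0) : Prop :=
  ∃ (X : Type u) (_ : AddCommGroup X) (_ : Module ℂ X) (bm : Bimod A B X),
    bm.IsEquivalence ∧
      ∃ lam : X →ₗ[ℂ] X ⊗[ℂ] H0, IsTwistedCoactionBimod Δ0 ε0 bm ρ u σ v lam

end BimodCoaction
/-! ### A finite dimensional C*-Hopf algebra together with its dual -/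

/-- A finite dimensional C*-Hopf algebra `H` together with its dual C*-Hopf algebra `H0`:
Hopf algebra structures on both, a perfect pairing compatible with all the structure, and
the distinguished (Haar) projections `e ∈ H` and `τ ∈ H0`. -/
structure HopfPairData (H H0 : Type u) [Ring H] [Algebra ℂ H] [StarRing H] [StarModule ℂ H]
    [FiniteDimensional ℂ H] [Ring H0] [Algebra ℂ H0] [StarRing H0] [StarModule ℂ H0]
    [FiniteDimensional ℂ H0] where
  dH : HopfAlgData H
  dH0 : HopfAlgData H0
  pair : H →ₗ[ℂ] H0 →ₗ[ℂ] ℂ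
  perfect : Function.Bijective fun h => pair h
  perfect' : Function.Bijective fun φ => pair.flip φ
  pair_mul_left : ∀ (h l : H) (φ : H0) (n : ℕ) (φ1 φ2 : Fin n → H0),
      dH0.comul φ = ∑ i, φ1 i ⊗ₜ φ2 i →
      pair (h * l) φ = ∑ i, pair h (φ1 i) * pair l (φ2 i)
  pair_mul_right : ∀ (h : H) (φ ψ : H0) (n : ℕ) (h1 h2 : Fin n → H),
      dH.comul h = ∑ i, h1 i ⊗ₜ h2 i →
      pair h (φ * ψ) = ∑ i, pair (h1 i) φ * pair (h2 i) ψ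
  pair_one_left : ∀ φ, pair 1 φ = dH0.counit φ
  pair_one_right : ∀ h, pair h 1 = dH.counit h
  pair_antipode : ∀ h φ, pair (dH.antipode h) φ = pair h (dH0.antipode φ)
  pair_star : ∀ h φ, pair (star h) φ = starRingEnd ℂ (pair h (star (dH0.antipode φ)))
  pair_star' : ∀ h φ, pair h (star φ) = starRingEnd ℂ (pair (star (dH.antipode h)) φ)
  haar : H
  haar_star : star haar = haar
  haar_idem : haar * haar = haar
  haar_absorb : ∀ h, h * haar = dH.counit h • haar
  haar_absorb' : ∀ h, haar * h = dH.counit h • haar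
  counit_haar : dH.counit haar = 1
  haar0 : H0
  haar0_star : star haar0 = haar0
  haar0_idem : haar0 * haar0 = haar0
  haar0_absorb : ∀ φ, φ * haar0 = dH0.counit φ • haar0
  haar0_absorb' : ∀ φ, haar0 * φ = dH0.counit φ • haar0
  counit_haar0 : dH0.counit haar0 = 1

section DualAct
variable {H H0 : Type u} [Ring H] [Algebra ℂ H] [StarRing H] [StarModule ℂ H]
    [FiniteDimensional ℂ H] [Ring H0] [Algebra ℂ H0] [StarRing H0] [StarModule ℂ H0]
    [FiniteDimensional ℂ H0]

/-- The action of `h ∈ H` on `M` induced by a coaction-type map `ρ : M → M ⊗ H0` of the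
dual `H0`:  `h ·_ρ m = (id ⊗ h)(ρ m)`. -/
def coactAct {M : Type u} [AddCommGroup M] [Module ℂ M] (dp : HopfPairData H H0)
    (ρ : M →ₗ[ℂ] M ⊗[ℂ] H0) (h : H) (m : M) : M :=
  appRight (dp.pair h) (ρ m)

end DualAct

/-! ### Packaged coacted C*-algebras -/

/-- A unital C*-algebra equipped with a linear map `A → A ⊗ H0` (a candidate coaction
of `H0`). -/
structure CoactedCStar (H0 : Type u) [Ring H0] [Algebra ℂ H0] [StarRing H0]
    [StarModule ℂ H0] [FiniteDimensional ℂ H0] : Type (u + 1) where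
  carrier : Type u
  [cstar : CStarAlgebra carrier]
  [smod : StarModule ℂ carrier]
  coact : carrier →ₗ[ℂ] carrier ⊗[ℂ] H0

attribute [instance] CoactedCStar.cstar CoactedCStar.smod

/-! ### Contractions and semilinear operations on tensor products -/

section Tensor

variable {M N P Q R C : Type*} [AddCommGroup M] [Module ℂ M] [AddCommGroup N] [Module ℂ N]
  [AddCommGroup P] [Module ℂ P] [AddCommGroup Q] [Module ℂ Q] [AddCommGroup R] [Module ℂ R]

@[simp]
theorem appRight_tmul [AddCommGroup C] [Module ℂ C] (f : C →ₗ[ℂ] ℂ) (m : M) (c : C) :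
    appRight f (m ⊗ₜ[ℂ] c) = f c • m := by
  simp [appRight]

theorem tcoord_tmul [AddCommGroup C] [Module ℂ C] [FiniteDimensional ℂ C]
    (i : Fin (Module.finrank ℂ C)) (m : M) (c : C) :
    tcoord i (m ⊗ₜ[ℂ] c) = (Module.finBasis ℂ C).repr c i • m := by
  simp [tcoord]

/-- An operation in two variables that is semilinear in each of them, along `s` and `t`. -/
structure IsSesqui (s t : ℂ →+* ℂ) (op : P → Q → R) : Prop where
  add_left : ∀ p p' q, op (p + p') q = op p q + op p' q
  add_right : ∀ p q q', op p (q + q') = op p q + op p q'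
  smul_left : ∀ (c : ℂ) p q, op (c • p) q = s c • op p q
  smul_right : ∀ (c : ℂ) p q, op p (c • q) = t c • op p q

namespace IsSesqui

variable {s t : ℂ →+* ℂ} {op : P → Q → R}

theorem sum_left (h : IsSesqui s t op) {ι : Type*} (I : Finset ι) (f : ι → P) (q : Q) :
    op (∑ i ∈ I, f i) q = ∑ i ∈ I, op (f i) q :=
  map_sum (AddMonoidHom.mk' (fun p => op p q) fun p p' => h.add_left p p' q) f I

theorem sum_right (h : IsSesqui s t op) {ι : Type*} (I : Finset ι) (p : P) (f : ι → Q) :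
    op p (∑ i ∈ I, f i) = ∑ i ∈ I, op p (f i) :=
  map_sum (AddMonoidHom.mk' (op p) (h.add_right p)) f I

theorem zero_left (h : IsSesqui s t op) (q : Q) : op 0 q = 0 :=
  map_zero (AddMonoidHom.mk' (fun p => op p q) fun p p' => h.add_left p p' q)

theorem zero_right (h : IsSesqui s t op) (p : P) : op p 0 = 0 :=
  map_zero (AddMonoidHom.mk' (op p) (h.add_right p))

end IsSesqui

variable [Ring C] [Algebra ℂ C]

theorem isSesqui_mul : IsSesqui (RingHom.id ℂ) (RingHom.id ℂ) (fun c d : C => c * d) where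
  add_left := by simp [add_mul]
  add_right := by simp [mul_add]
  smul_left := by simp
  smul_right := by simp

theorem isSesqui_mul_star [StarRing C] [StarModule ℂ C] :
    IsSesqui (RingHom.id ℂ) (starRingEnd ℂ) (fun c d : C => c * star d) where
  add_left := by simp [add_mul]
  add_right := by simp [mul_add]
  smul_left := by simp
  smul_right := by simp

theorem isSesqui_star_mul [StarRing C] [StarModule ℂ C] :
    IsSesqui (starRingEnd ℂ) (RingHom.id ℂ) (fun c d : C => star c * d) where
  add_left := by simp [add_mul]
  add_right := by simp [mul_add]
  smul_left := by simp
  smul_right := by simp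

variable [FiniteDimensional ℂ C] {s t : ℂ →+* ℂ} {op : P → Q → R} {cop : C → C → C}

theorem tmix_add_left (h : IsSesqui s t op) (a a' : P ⊗[ℂ] C) (b : Q ⊗[ℂ] C) :
    tmix op cop (a + a') b = tmix op cop a b + tmix op cop a' b := by
  simp [tmix, h.add_left, TensorProduct.add_tmul, Finset.sum_add_distrib]

theorem tmix_add_right (h : IsSesqui s t op) (a : P ⊗[ℂ] C) (b b' : Q ⊗[ℂ] C) :
    tmix op cop a (b + b') = tmix op cop a b + tmix op cop a b' := by
  simp [tmix, h.add_right, TensorProduct.add_tmul, Finset.sum_add_distrib]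

theorem tmix_zero_left (h : IsSesqui s t op) (b : Q ⊗[ℂ] C) : tmix op cop 0 b = 0 := by
  simp [tmix, h.zero_left]

theorem tmix_zero_right (h : IsSesqui s t op) (a : P ⊗[ℂ] C) : tmix op cop a 0 = 0 := by
  simp [tmix, h.zero_right]

theorem tmix_smul_right (h : IsSesqui s (RingHom.id ℂ) op) (c : ℂ) (a : P ⊗[ℂ] C)
    (b : Q ⊗[ℂ] C) : tmix op cop a (c • b) = c • tmix op cop a b := by
  simp [tmix, h.smul_right, Finset.smul_sum, TensorProduct.smul_tmul']

theorem tmix_sum_left (h : IsSesqui s t op) {ι : Type*} (I : Finset ι) (f : ι → P ⊗[ℂ] C)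
    (b : Q ⊗[ℂ] C) : tmix op cop (∑ i ∈ I, f i) b = ∑ i ∈ I, tmix op cop (f i) b :=
  map_sum (AddMonoidHom.mk' (fun a => tmix op cop a b) fun a a' => tmix_add_left h a a' b) f I

theorem tmix_sum_right (h : IsSesqui s t op) {ι : Type*} (I : Finset ι) (a : P ⊗[ℂ] C)
    (f : ι → Q ⊗[ℂ] C) : tmix op cop a (∑ i ∈ I, f i) = ∑ i ∈ I, tmix op cop a (f i) :=
  map_sum (AddMonoidHom.mk' (tmix op cop a) (tmix_add_right h a)) f I

theorem tmix_tmul (h : IsSesqui s t op) (hc : IsSesqui s t cop) (p : P) (c : C) (q : Q) (d : C) :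
    tmix op cop (p ⊗ₜ[ℂ] c) (q ⊗ₜ[ℂ] d) = op p q ⊗ₜ[ℂ] cop c d := by
  conv_rhs => rw [← (Module.finBasis ℂ C).sum_repr c, ← (Module.finBasis ℂ C).sum_repr d]
  simp only [tmix, tcoord_tmul, h.smul_left, h.smul_right, hc.sum_left, hc.sum_right,
    hc.smul_left, hc.smul_right, TensorProduct.tmul_sum, TensorProduct.tmul_smul,
    TensorProduct.smul_tmul', smul_smul]

/-- Associativity of operations on the two tensor factors passes to the combined operations. -/
theorem tmix_assoc {S T U : Type*} [AddCommGroup S] [Module ℂ S] [AddCommGroup T] [Module ℂ T]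
    [AddCommGroup U] [Module ℂ U]
    {s₁ t₁ s₂ t₂ s₃ t₃ s₄ t₄ : ℂ →+* ℂ} {op₁ : P → Q → R} {op₂ : R → S → T} {op₃ : Q → S → U}
    {op₄ : P → U → T} {c₁ c₂ c₃ c₄ : C → C → C}
    (h₁ : IsSesqui s₁ t₁ op₁) (h₂ : IsSesqui s₂ t₂ op₂) (h₃ : IsSesqui s₃ t₃ op₃)
    (h₄ : IsSesqui s₄ t₄ op₄) (k₁ : IsSesqui s₁ t₁ c₁) (k₂ : IsSesqui s₂ t₂ c₂)
    (k₃ : IsSesqui s₃ t₃ c₃) (k₄ : IsSesqui s₄ t₄ c₄)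
    (hop : ∀ p q s, op₂ (op₁ p q) s = op₄ p (op₃ q s))
    (hc : ∀ a b c, c₂ (c₁ a b) c = c₄ a (c₃ b c))
    (x : P ⊗[ℂ] C) (y : Q ⊗[ℂ] C) (z : S ⊗[ℂ] C) :
    tmix op₂ c₂ (tmix op₁ c₁ x y) z = tmix op₄ c₄ x (tmix op₃ c₃ y z) := by
  induction x with
  | zero => simp only [tmix_zero_left h₁, tmix_zero_left h₂, tmix_zero_left h₄]
  | add x x' hx hx' => simp only [tmix_add_left h₁, tmix_add_left h₂, tmix_add_left h₄, hx, hx']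
  | tmul p a =>
    induction y with
    | zero => simp only [tmix_zero_left h₂, tmix_zero_right h₁, tmix_zero_left h₃,
        tmix_zero_right h₄]
    | add y y' hy hy' => simp only [tmix_add_left h₂, tmix_add_right h₁, tmix_add_left h₃,
        tmix_add_right h₄, hy, hy']
    | tmul q b =>
      induction z with
      | zero => simp only [tmix_zero_right h₂, tmix_zero_right h₃, tmix_zero_right h₄]
      | add z z' hz hz' => simp only [tmix_add_right h₂, tmix_add_right h₃, tmix_add_right h₄,
          hz, hz']
      | tmul s c =>
        simp only [tmix_tmul h₁ k₁, tmix_tmul h₂ k₂, tmix_tmul h₃ k₃, tmix_tmul h₄ k₄, hop, hc]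

/-- The conjugate linear map `m ⊗ c ↦ f m ⊗ star c` induced by a conjugate linear `f`. -/
def tconj [StarRing C] (f : M → N) (x : M ⊗[ℂ] C) : N ⊗[ℂ] C :=
  ∑ i, f (tcoord i x) ⊗ₜ star (Module.finBasis ℂ C i)

variable [StarRing C] [StarModule ℂ C]

theorem tstarWith_eq_tconj (f : M → M) (x : M ⊗[ℂ] C) : tstarWith f x = tconj f x := rfl

theorem tconj_add (f : M →ₛₗ[starRingEnd ℂ] N) (x y : M ⊗[ℂ] C) :
    tconj f (x + y) = tconj f x + tconj f y := by
  simp [tconj, TensorProduct.add_tmul, Finset.sum_add_distrib]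

theorem tconj_zero (f : M →ₛₗ[starRingEnd ℂ] N) : tconj f (0 : M ⊗[ℂ] C) = 0 := by
  simp [tconj]

theorem tconj_smul (f : M →ₛₗ[starRingEnd ℂ] N) (c : ℂ) (x : M ⊗[ℂ] C) :
    tconj f (c • x) = starRingEnd ℂ c • tconj f x := by
  simp [tconj, Finset.smul_sum, TensorProduct.smul_tmul']

theorem tconj_tmul (f : M →ₛₗ[starRingEnd ℂ] N) (m : M) (c : C) :
    tconj f (m ⊗ₜ[ℂ] c) = f m ⊗ₜ star c := by
  conv_rhs => rw [← (Module.finBasis ℂ C).sum_repr c]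
  simp only [tconj, tcoord_tmul, map_smulₛₗ, star_sum, star_smul, TensorProduct.tmul_sum,
    TensorProduct.tmul_smul, TensorProduct.smul_tmul', starRingEnd_apply]

/-- The star operation as a conjugate linear map. -/
def starSemi (A : Type*) [Ring A] [Algebra ℂ A] [StarRing A] [StarModule ℂ A] :
    A →ₛₗ[starRingEnd ℂ] A where
  toFun := star
  map_add' := star_add
  map_smul' := by simp

end Tensor

/-! ### Elementary properties of Hilbert bimodules -/

namespace Bimod

variable {A B X : Type u} [Ring A] [Algebra ℂ A] [StarRing A]
    [Ring B] [Algebra ℂ B] [StarRing B] [AddCommGroup X] [Module ℂ X] (bm : Bimod A B X)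

theorem isSesqui_ls : IsSesqui (RingHom.id ℂ) (RingHom.id ℂ) bm.ls :=
  ⟨bm.ls_add, bm.ls_add', bm.ls_smul, bm.ls_smul'⟩

theorem isSesqui_rs : IsSesqui (RingHom.id ℂ) (RingHom.id ℂ) bm.rs :=
  ⟨fun p p' q => bm.rs_add' p p' q, bm.rs_add, bm.rs_smul', bm.rs_smul⟩

theorem isSesqui_linn : IsSesqui (RingHom.id ℂ) (starRingEnd ℂ) bm.linn :=
  ⟨bm.linn_add_left, bm.linn_add_right, bm.linn_smul_left, bm.linn_smul_right⟩

theorem isSesqui_rinn : IsSesqui (starRingEnd ℂ) (RingHom.id ℂ) bm.rinn :=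
  ⟨bm.rinn_add_left, bm.rinn_add_right, bm.rinn_smul_left, bm.rinn_smul_right⟩

theorem linn_ls_right (a : A) (x y : X) : bm.linn x (bm.ls a y) = bm.linn x y * star a := by
  rw [← bm.linn_star, bm.linn_ls, star_mul, bm.linn_star]

theorem rinn_rs_left (x y : X) (b : B) : bm.rinn (bm.rs x b) y = star b * bm.rinn x y := by
  rw [← bm.rinn_star, bm.rinn_rs, star_mul, bm.rinn_star]

end Bimod

/-! ### The conjugate bimodule -/

/-- The conjugate of a complex vector space. -/
def Conj (X : Type u) : Type u := X

section Conj

variable {X : Type u} [AddCommGroup X] [Module ℂ X]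

instance : AddCommGroup (Conj X) := inferInstanceAs (AddCommGroup X)

instance : Module ℂ (Conj X) := Module.compHom X (starRingEnd ℂ)

/-- The canonical conjugate linear bijection from a vector space to its conjugate. -/
def Conj.mk : X →ₛₗ[starRingEnd ℂ] Conj X where
  toFun x := x
  map_add' _ _ := rfl
  map_smul' c x := by
    change c • x = starRingEnd ℂ (starRingEnd ℂ c) • x
    rw [Complex.conj_conj]

/-- The canonical conjugate linear bijection from the conjugate of a vector space. -/
def Conj.out : Conj X →ₛₗ[starRingEnd ℂ] X where
  toFun x := x
  map_add' _ _ := rfl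
  map_smul' _ _ := rfl

@[simp] theorem Conj.out_mk (x : X) : Conj.out (Conj.mk x) = x := rfl

@[simp] theorem Conj.mk_out (x : Conj X) : Conj.mk (Conj.out x) = x := rfl

end Conj

section ConjBimod

variable {A B X : Type u} [CStarAlgebra A] [CStarAlgebra B] [AddCommGroup X] [Module ℂ X]

theorem Bimod.linn_def (bm : Bimod A B X) (hbm : bm.IsEquivalence) (x : X)
    (hx : bm.linn x x = 0) : x = 0 := by
  refine bm.rinn_def x ?_
  have h : bm.rinn x x * bm.rinn x x = 0 := by
    rw [← bm.rinn_rs, ← hbm.1, hx, bm.isSesqui_ls.zero_left, bm.isSesqui_rinn.zero_right]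
  rw [← CStarRing.star_mul_self_eq_zero_iff, bm.rinn_star, h]

/-- The conjugate of an equivalence bimodule. -/
def Bimod.conj (bm : Bimod A B X) (hbm : bm.IsEquivalence) : Bimod B A (Conj X) where
  ls b x := Conj.mk (bm.rs x.out (star b))
  rs x a := Conj.mk (bm.ls (star a) x.out)
  linn x y := bm.rinn x.out y.out
  rinn x y := bm.linn x.out y.out
  ls_one := by simp [bm.rs_one]
  ls_mul := by simp [bm.rs_mul]
  ls_add := by simp [bm.rs_add]
  ls_add' := by simp [bm.rs_add']
  ls_smul := by simp [bm.rs_smul]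
  ls_smul' := by simp [bm.rs_smul']
  rs_one := by simp [bm.ls_one]
  rs_mul := by simp [bm.ls_mul]
  rs_add := by simp [bm.ls_add]
  rs_add' := by simp [bm.ls_add']
  rs_smul := by simp [bm.ls_smul]
  rs_smul' := by simp [bm.ls_smul']
  ls_rs := by simp [bm.ls_rs]
  linn_add_left := by simp [bm.rinn_add_left]
  linn_add_right := by simp [bm.rinn_add_right]
  rinn_add_left := by simp [bm.linn_add_left]
  rinn_add_right := by simp [bm.linn_add_right]
  linn_smul_left := by simp [bm.rinn_smul_left]
  linn_smul_right := by simp [bm.rinn_smul_right]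
  rinn_smul_left := by simp [bm.linn_smul_left]
  rinn_smul_right := by simp [bm.linn_smul_right]
  linn_star := by simp [bm.rinn_star]
  rinn_star := by simp [bm.linn_star]
  linn_ls := by simp [bm.rinn_rs_left]
  rinn_rs := by simp [bm.linn_ls_right]
  linn_rs := by simp [bm.rinn_ls]
  rinn_ls := by simp [bm.linn_rs]
  linn_pos x := bm.rinn_pos x.out
  rinn_pos x := bm.linn_pos x.out
  rinn_def x hx := bm.linn_def hbm x.out hx

theorem Bimod.conj_isEquivalence (bm : Bimod A B X) (hbm : bm.IsEquivalence) :
    (bm.conj hbm).IsEquivalence := by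
  refine ⟨fun x y z => ?_, hbm.2.2, hbm.2.1⟩
  simp [Bimod.conj, bm.rinn_star, bm.linn_star, hbm.1]

variable {H0 : Type u} [Ring H0] [Algebra ℂ H0] [StarRing H0] [StarModule ℂ H0]
  [FiniteDimensional ℂ H0]

/-- The map on the conjugate bimodule induced by a coaction. -/
def conjCoact (lam : X →ₗ[ℂ] X ⊗[ℂ] H0) : Conj X →ₗ[ℂ] Conj X ⊗[ℂ] H0 where
  toFun x := tconj Conj.mk (lam x.out)
  map_add' := by simp [tconj_add]
  map_smul' := by simp [tconj_smul]

theorem conjCoact_isWeakCoactionBimod {ε0 : H0 →ₗ[ℂ] ℂ}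
    (hε : ∀ h, ε0 (star h) = starRingEnd ℂ (ε0 h)) {bm : Bimod A B X} (hbm : bm.IsEquivalence)
    {ρ : A →ₗ[ℂ] A ⊗[ℂ] H0} {σ : B →ₗ[ℂ] B ⊗[ℂ] H0}
    (hρ : IsWeakCoaction ε0 ρ) (hσ : IsWeakCoaction ε0 σ)
    {lam : X →ₗ[ℂ] X ⊗[ℂ] H0} (hlam : IsWeakCoactionBimod ε0 bm ρ σ lam) :
    IsWeakCoactionBimod ε0 (bm.conj hbm) σ ρ (conjCoact lam) := by
  refine ⟨fun b x => ?_, fun x a => ?_, fun x y => ?_, fun x y => ?_, fun x => ?_⟩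
  · change tconj Conj.mk (lam (bm.rs x.out (star b))) = tact _ _ (tconj Conj.mk (lam x.out))
    rw [hlam.rs_compat, hσ.map_star, tstarWith_eq_tconj, tact, tact]
    change tconj _ (tmix _ _ _ (tconj (starSemi B) _)) = _
    have h1 := (bm.conj hbm).isSesqui_ls
    have h2 := bm.isSesqui_rs
    generalize σ b = s
    generalize lam x.out = t
    induction s with
    | zero => simp only [tconj_zero, tmix_zero_left h1, tmix_zero_right h2]
    | add s s' hs hs' => simp only [tconj_add, tmix_add_left h1, tmix_add_right h2, hs, hs']
    | tmul b h =>
      induction t with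
      | zero => simp only [tconj_zero, tmix_zero_right h1, tmix_zero_left h2]
      | add t t' ht ht' => simp only [tconj_add, tmix_add_right h1, tmix_add_left h2, ht, ht']
      | tmul x k =>
        simp only [tconj_tmul, tmix_tmul h1 isSesqui_mul, tmix_tmul h2 isSesqui_mul, star_mul,
          star_star]
        rfl
  · change tconj Conj.mk (lam (bm.ls (star a) x.out)) = tact _ (tconj Conj.mk (lam x.out)) _
    rw [hlam.ls_compat, hρ.map_star, tstarWith_eq_tconj, tact, tact]
    change tconj _ (tmix _ _ (tconj (starSemi A) _) _) = _
    have h1 := (bm.conj hbm).isSesqui_rs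
    have h2 := bm.isSesqui_ls
    generalize ρ a = s
    generalize lam x.out = t
    induction s with
    | zero => simp only [tconj_zero, tmix_zero_right h1, tmix_zero_left h2]
    | add s s' hs hs' => simp only [tconj_add, tmix_add_right h1, tmix_add_left h2, hs, hs']
    | tmul b h =>
      induction t with
      | zero => simp only [tconj_zero, tmix_zero_left h1, tmix_zero_right h2]
      | add t t' ht ht' => simp only [tconj_add, tmix_add_left h1, tmix_add_right h2, ht, ht']
      | tmul x k =>
        simp only [tconj_tmul, tmix_tmul h1 isSesqui_mul, tmix_tmul h2 isSesqui_mul, star_mul,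
          star_star]
        rfl
  · change σ (bm.rinn x.out y.out) = tinnL _ (tconj Conj.mk (lam x.out)) (tconj Conj.mk (lam y.out))
    rw [hlam.rinn_compat, tinnL, tinnR]
    have h1 := (bm.conj hbm).isSesqui_linn
    have h2 := bm.isSesqui_rinn
    generalize lam x.out = s
    generalize lam y.out = t
    induction s with
    | zero => simp only [tconj_zero, tmix_zero_left h1, tmix_zero_left h2]
    | add s s' hs hs' => simp only [tconj_add, tmix_add_left h1, tmix_add_left h2, hs, hs']
    | tmul b h =>
      induction t with
      | zero => simp only [tconj_zero, tmix_zero_right h1, tmix_zero_right h2]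
      | add t t' ht ht' => simp only [tconj_add, tmix_add_right h1, tmix_add_right h2, ht, ht']
      | tmul x k =>
        simp only [tconj_tmul, tmix_tmul h1 isSesqui_mul_star, tmix_tmul h2 isSesqui_star_mul,
          star_star]
        rfl
  · change ρ (bm.linn x.out y.out) = tinnR _ (tconj Conj.mk (lam x.out)) (tconj Conj.mk (lam y.out))
    rw [hlam.linn_compat, tinnL, tinnR]
    have h1 := (bm.conj hbm).isSesqui_rinn
    have h2 := bm.isSesqui_linn
    generalize lam x.out = s
    generalize lam y.out = t
    induction s with
    | zero => simp only [tconj_zero, tmix_zero_left h1, tmix_zero_left h2]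
    | add s s' hs hs' => simp only [tconj_add, tmix_add_left h1, tmix_add_left h2, hs, hs']
    | tmul b h =>
      induction t with
      | zero => simp only [tconj_zero, tmix_zero_right h1, tmix_zero_right h2]
      | add t t' ht ht' => simp only [tconj_add, tmix_add_right h1, tmix_add_right h2, ht, ht']
      | tmul x k =>
        simp only [tconj_tmul, tmix_tmul h1 isSesqui_star_mul, tmix_tmul h2 isSesqui_mul_star,
          star_star]
        rfl
  · have key : ∀ t : X ⊗[ℂ] H0, appRight ε0 (tconj Conj.mk t) = Conj.mk (appRight ε0 t) := by
      intro t
      induction t with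
      | zero => simp [tconj_zero]
      | add t t' ht ht' => simp [tconj_add, ht, ht']
      | tmul x k => simp [tconj_tmul, hε]
    change appRight ε0 (tconj Conj.mk (lam x.out)) = x
    rw [key, hlam.counital, Conj.mk_out]

end ConjBimod

/-! ### The identity bimodule -/

section Refl

variable (A : Type u) [CStarAlgebra A]

/-- A C*-algebra as an equivalence bimodule over itself. -/
def idBimod : Bimod A A A where
  ls a x := a * x
  rs x a := x * a
  linn x y := x * star y
  rinn x y := star x * y
  ls_one := one_mul
  ls_mul := mul_assoc
  ls_add := add_mul
  ls_add' := mul_add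
  ls_smul := by simp
  ls_smul' := by simp
  rs_one := mul_one
  rs_mul x b b' := (mul_assoc x b b').symm
  rs_add := mul_add
  rs_add' := add_mul
  rs_smul := by simp
  rs_smul' := by simp
  ls_rs a x b := (mul_assoc a x b).symm
  linn_add_left := by simp [add_mul]
  linn_add_right := by simp [mul_add]
  rinn_add_left := by simp [add_mul]
  rinn_add_right := by simp [mul_add]
  linn_smul_left := by simp
  linn_smul_right := by simp
  rinn_smul_left := by simp
  rinn_smul_right := by simp
  linn_star := by simp
  rinn_star := by simp
  linn_ls := by simp [mul_assoc]
  rinn_rs := by simp [mul_assoc]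
  linn_rs := by simp [mul_assoc]
  rinn_ls := by simp [mul_assoc]
  linn_pos x := ⟨star x, by simp⟩
  rinn_pos x := ⟨x, rfl⟩
  rinn_def x hx := CStarRing.star_mul_self_eq_zero_iff x |>.1 hx

theorem idBimod_isEquivalence : (idBimod A).IsEquivalence := by
  refine ⟨fun x y z => mul_assoc _ _ _, ?_, ?_⟩
  · refine eq_top_iff.2 fun a _ => Submodule.subset_span ⟨(a, 1), ?_⟩
    simp [idBimod]
  · refine eq_top_iff.2 fun a _ => Submodule.subset_span ⟨(1, a), ?_⟩
    simp [idBimod]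

variable {A} {H0 : Type u} [Ring H0] [Algebra ℂ H0] [StarRing H0] [StarModule ℂ H0]
  [FiniteDimensional ℂ H0]

theorem tmix_mul (s t : A ⊗[ℂ] H0) :
    tmix (fun a b : A => a * b) (fun c d : H0 => c * d) s t = s * t := by
  have h := isSesqui_mul (C := A)
  induction s with
  | zero => simp only [tmix_zero_left h, zero_mul]
  | add s s' hs hs' => simp only [tmix_add_left h, hs, hs', add_mul]
  | tmul a c =>
    induction t with
    | zero => simp only [tmix_zero_right h, mul_zero]
    | add t t' ht ht' => simp only [tmix_add_right h, ht, ht', mul_add]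
    | tmul b d => simp only [tmix_tmul h isSesqui_mul, Algebra.TensorProduct.tmul_mul_tmul]

theorem tmix_mul_star (s t : A ⊗[ℂ] H0) :
    tmix (fun a b : A => a * star b) (fun c d : H0 => c * star d) s t
      = s * tstarWith star t := by
  have h := isSesqui_mul_star (C := A)
  change _ = s * tconj (starSemi A) t
  induction s with
  | zero => simp only [tmix_zero_left h, zero_mul]
  | add s s' hs hs' => simp only [tmix_add_left h, hs, hs', add_mul]
  | tmul a c =>
    induction t with
    | zero => simp only [tmix_zero_right h, tconj_zero, mul_zero]
    | add t t' ht ht' => simp only [tmix_add_right h, tconj_add, ht, ht', mul_add]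
    | tmul b d =>
      simp only [tmix_tmul h isSesqui_mul_star, tconj_tmul, Algebra.TensorProduct.tmul_mul_tmul]
      rfl

theorem tmix_star_mul (s t : A ⊗[ℂ] H0) :
    tmix (fun a b : A => star a * b) (fun c d : H0 => star c * d) s t
      = tstarWith star s * t := by
  have h := isSesqui_star_mul (C := A)
  change _ = tconj (starSemi A) s * t
  induction s with
  | zero => simp only [tmix_zero_left h, tconj_zero, zero_mul]
  | add s s' hs hs' => simp only [tmix_add_left h, tconj_add, hs, hs', add_mul]
  | tmul a c =>
    induction t with
    | zero => simp only [tmix_zero_right h, mul_zero]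
    | add t t' ht ht' => simp only [tmix_add_right h, ht, ht', mul_add]
    | tmul b d =>
      simp only [tmix_tmul h isSesqui_star_mul, tconj_tmul, Algebra.TensorProduct.tmul_mul_tmul]
      rfl

theorem idBimod_isWeakCoactionBimod {ε0 : H0 →ₗ[ℂ] ℂ} {ρ : A →ₗ[ℂ] A ⊗[ℂ] H0}
    (hρ : IsWeakCoaction ε0 ρ) : IsWeakCoactionBimod ε0 (idBimod A) ρ ρ ρ where
  ls_compat a x := (hρ.map_mul a x).trans (tmix_mul _ _).symm
  rs_compat a x := (hρ.map_mul a x).trans (tmix_mul _ _).symm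
  linn_compat x y := by
    change ρ (x * star y) = tmix (fun a b : A => a * star b) (fun c d : H0 => c * star d) _ _
    rw [hρ.map_mul, hρ.map_star, tmix_mul_star]
  rinn_compat x y := by
    change ρ (star x * y) = tmix (fun a b : A => star a * b) (fun c d : H0 => star c * d) _ _
    rw [hρ.map_mul, hρ.map_star, tmix_star_mul]
  counital := hρ.counital

end Refl

/-! ### Finite bases of equivalence bimodules -/

section Basis

variable {A B X : Type u} [CStarAlgebra A] [CStarAlgebra B] [AddCommGroup X] [Module ℂ X]

theorem exists_sum_star_mul_self {ι : Type*} (s : Finset ι) (f : ι → A)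
    (hf : ∀ i ∈ s, ∃ a, f i = star a * a) : ∃ a, ∑ i ∈ s, f i = star a * a := by
  let _ := CStarAlgebra.spectralOrder A
  have _ := CStarAlgebra.spectralOrderedRing A
  refine CStarAlgebra.nonneg_iff_eq_star_mul_self.1 (Finset.sum_nonneg fun i hi => ?_)
  obtain ⟨a, ha⟩ := hf i hi
  exact ha ▸ star_mul_self_nonneg a

theorem eq_zero_of_sum_eq_zero {ι : Type*} (s : Finset ι) (f : ι → A)
    (hf : ∀ i ∈ s, ∃ a, f i = star a * a) (h : ∑ i ∈ s, f i = 0) : ∀ i ∈ s, f i = 0 := by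
  let _ := CStarAlgebra.spectralOrder A
  have _ := CStarAlgebra.spectralOrderedRing A
  refine (Finset.sum_eq_zero_iff_of_nonneg fun i hi => ?_).1 h
  obtain ⟨a, ha⟩ := hf i hi
  exact ha ▸ star_mul_self_nonneg a

/-- An element of the form `1 + star q * q` is congruent to the identity. -/
theorem exists_mul_mul_star_eq_one {p q : A} (hpq : p = 1 + star q * q) :
    ∃ s : A, s * p * star s = 1 := by
  let _ := CStarAlgebra.spectralOrder A
  have _ := CStarAlgebra.spectralOrderedRing A
  have h1 : (1 : A) ≤ p := by rw [hpq]; simp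
  have h0 : 0 ≤ p := zero_le_one.trans h1
  have hu : IsUnit p := CStarAlgebra.isUnit_of_le 1 h1
  have hc := CFC.sqrt_mul_sqrt_self p h0
  have hcu : IsUnit (CFC.sqrt p) := by
    rw [← hc] at hu
    exact (Commute.isUnit_mul_iff (Commute.refl _)).1 hu |>.1
  have hsa : star (CFC.sqrt p) = CFC.sqrt p :=
    (IsSelfAdjoint.of_nonneg (CFC.sqrt_nonneg p)).star_eq
  obtain ⟨c, hcc⟩ := hcu
  rw [← hcc] at hc hsa
  refine ⟨((c⁻¹ : Aˣ) : A), ?_⟩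
  have h2 : star ((c⁻¹ : Aˣ) : A) = ((c⁻¹ : Aˣ) : A) := by
    rw [← Units.coe_star_inv, ← Units.ext_iff]
    congr 1
    exact Units.ext hsa
  rw [h2, ← hc]
  simp

theorem Bimod.IsEquivalence.exists_sum_linn_eq_one {bm : Bimod A B X} (hbm : bm.IsEquivalence) :
    ∃ (n : ℕ) (u : Fin n → X), ∑ k, bm.linn (u k) (u k) = 1 := by
  have hmem : (1 : A) ∈ Submodule.span ℂ (Set.range fun p : X × X => bm.linn p.1 p.2) :=
    hbm.2.1 ▸ Submodule.mem_top
  obtain ⟨n, f, g, hg⟩ := (Submodule.mem_span_set').1 hmem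
  choose p hp using fun i => (g i).2
  have hxy : ∑ i, bm.linn (f i • (p i).1) (p i).2 = 1 := by
    rw [← hg]
    exact Finset.sum_congr rfl fun i _ => by rw [bm.linn_smul_left, ← hp i]
  set x : Fin n → X := fun i => f i • (p i).1
  set y : Fin n → X := fun i => (p i).2
  have hyx : ∑ i, bm.linn (y i) (x i) = 1 := by
    simpa [bm.linn_star] using congrArg star hxy
  obtain ⟨q, hq⟩ := exists_sum_star_mul_self Finset.univ
    (fun i => bm.linn ((2⁻¹ : ℂ) • (x i - y i)) ((2⁻¹ : ℂ) • (x i - y i)))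
    fun i _ => bm.linn_pos _
  obtain ⟨s, hs⟩ := exists_mul_mul_star_eq_one (A := A) (q := q)
    (p := ∑ i, bm.linn ((2⁻¹ : ℂ) • (x i + y i)) ((2⁻¹ : ℂ) • (x i + y i))) (by
      rw [← hq]
      have hsub : ∀ a b : X, a - b = a + (-1 : ℂ) • b := fun a b => by
        rw [neg_one_smul, sub_eq_add_neg]
      have h1 : (1 : A) = (2⁻¹ : ℂ) • ∑ i, bm.linn (x i) (y i)
          + (2⁻¹ : ℂ) • ∑ i, bm.linn (y i) (x i) := by
        rw [hyx]
        change (1 : A) = (2⁻¹ : ℂ) • (∑ i, bm.linn (f i • (p i).1) (p i).2) + _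
        rw [hxy, ← add_smul]
        norm_num
      rw [h1, Finset.smul_sum, Finset.smul_sum, ← Finset.sum_add_distrib,
        ← Finset.sum_add_distrib]
      refine Finset.sum_congr rfl fun i _ => ?_
      simp only [hsub, bm.linn_smul_left, bm.linn_smul_right, bm.linn_add_left,
        bm.linn_add_right, map_neg, map_one, map_inv₀, map_ofNat]
      module)
  refine ⟨n, fun i => bm.ls s ((2⁻¹ : ℂ) • (x i + y i)), ?_⟩
  simp only [bm.linn_ls, bm.linn_ls_right]
  rw [← hs, Finset.mul_sum, Finset.sum_mul]
  simp only [mul_assoc]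

theorem Bimod.IsEquivalence.exists_sum_rinn_eq_one {bm : Bimod A B X} (hbm : bm.IsEquivalence) :
    ∃ (n : ℕ) (v : Fin n → X), ∑ k, bm.rinn (v k) (v k) = 1 := by
  obtain ⟨n, v, hv⟩ := (bm.conj_isEquivalence hbm).exists_sum_linn_eq_one
  exact ⟨n, fun k => (v k).out, hv⟩

theorem Bimod.IsEquivalence.sum_rs_rinn {bm : Bimod A B X} (hbm : bm.IsEquivalence) {n : ℕ}
    {u : Fin n → X} (hu : ∑ k, bm.linn (u k) (u k) = 1) (x : X) :
    ∑ k, bm.rs (u k) (bm.rinn (u k) x) = x := by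
  simp only [← hbm.1]
  rw [← bm.isSesqui_ls.sum_left, hu, bm.ls_one]

theorem Bimod.IsEquivalence.sum_ls_linn {bm : Bimod A B X} (hbm : bm.IsEquivalence) {n : ℕ}
    {v : Fin n → X} (hv : ∑ k, bm.rinn (v k) (v k) = 1) (x : X) :
    ∑ k, bm.ls (bm.linn x (v k)) (v k) = x := by
  simp only [hbm.1]
  rw [← bm.isSesqui_rs.sum_right, hv, bm.rs_one]

end Basis

/-! ### The interior tensor product -/

section Interior

variable {A B C X Y : Type u} [CStarAlgebra A] [CStarAlgebra B] [CStarAlgebra C]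
  [AddCommGroup X] [Module ℂ X] [AddCommGroup Y] [Module ℂ Y]
  {bmX : Bimod A B X} {n : ℕ} {u : Fin n → X}

/-- The interior tensor product `X ⊗_B Y`, realized by means of a finite basis `u` of `X` as
the range of the projection `(⟨u k, u l⟩)` acting on the `n`-fold direct sum of `Y`. -/
def interior (bmX : Bimod A B X) (bmY : Bimod B C Y) (u : Fin n → X) :
    Submodule ℂ (Fin n → Y) where
  carrier := {w | ∀ k, ∑ l, bmY.ls (bmX.rinn (u k) (u l)) (w l) = w k}
  add_mem' {a b} ha hb k := by
    simp only [Pi.add_apply, bmY.ls_add', Finset.sum_add_distrib, ha k, hb k]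
  zero_mem' k := by simp [bmY.isSesqui_ls.zero_right]
  smul_mem' c a ha k := by
    simp only [Pi.smul_apply, bmY.ls_smul', ← Finset.smul_sum, ha k]

/-- The elementary tensors in the interior tensor product. -/
def interiorMk (hX : bmX.IsEquivalence) (hu : ∑ k, bmX.linn (u k) (u k) = 1)
    (bmY : Bimod B C Y) (x : X) (y : Y) : interior bmX bmY u :=
  ⟨fun k => bmY.ls (bmX.rinn (u k) x) y, fun k => by
    simp only [← bmY.ls_mul, ← bmX.rinn_rs]
    rw [← bmY.isSesqui_ls.sum_left, ← bmX.isSesqui_rinn.sum_right, hX.sum_rs_rinn hu]⟩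

variable (hX : bmX.IsEquivalence) (hu : ∑ k, bmX.linn (u k) (u k) = 1) {bmY : Bimod B C Y}

theorem isSesqui_interiorMk :
    IsSesqui (RingHom.id ℂ) (RingHom.id ℂ) (interiorMk hX hu bmY) where
  add_left x x' y := by
    ext k
    simp [interiorMk, bmX.rinn_add_right, bmY.ls_add]
  add_right x y y' := by
    ext k
    simp [interiorMk, bmY.ls_add']
  smul_left c x y := by
    ext k
    simp [interiorMk, bmX.rinn_smul_right, bmY.ls_smul]
  smul_right c x y := by
    ext k
    simp [interiorMk, bmY.ls_smul']

theorem interiorMk_rs (x : X) (b : B) (y : Y) :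
    interiorMk hX hu bmY (bmX.rs x b) y = interiorMk hX hu bmY x (bmY.ls b y) := by
  ext k
  simp [interiorMk, bmX.rinn_rs, bmY.ls_mul]

theorem sum_interiorMk (w : interior bmX bmY u) :
    ∑ k, interiorMk hX hu bmY (u k) (w.1 k) = w := by
  ext k
  simpa [interiorMk] using w.2 k

theorem exists_eq_sum_interiorMk (w : interior bmX bmY u) :
    ∃ y : Fin n → Y, w = ∑ k, interiorMk hX hu bmY (u k) (y k) :=
  ⟨w.1, (sum_interiorMk hX hu w).symm⟩

/-- The left action on the interior tensor product. -/
def interiorLs (a : A) (w : interior bmX bmY u) : interior bmX bmY u :=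
  ∑ k, interiorMk hX hu bmY (bmX.ls a (u k)) (w.1 k)

/-- The right action on the interior tensor product. -/
def interiorRs (w : interior bmX bmY u) (c : C) : interior bmX bmY u :=
  ∑ k, interiorMk hX hu bmY (u k) (bmY.rs (w.1 k) c)

/-- The left inner product on the interior tensor product. -/
def interiorLinn (w w' : interior bmX bmY u) : A :=
  ∑ k, ∑ l, bmX.linn (bmX.rs (u k) (bmY.linn (w.1 k) (w'.1 l))) (u l)

/-- The right inner product on the interior tensor product. -/
def interiorRinn (w w' : interior bmX bmY u) : C :=
  ∑ k, bmY.rinn (w.1 k) (w'.1 k)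

theorem isSesqui_interiorLs :
    IsSesqui (RingHom.id ℂ) (RingHom.id ℂ) (interiorLs hX hu (bmY := bmY)) := by
  have h := isSesqui_interiorMk hX hu (bmY := bmY)
  constructor <;> intros <;>
    simp [interiorLs, h.add_left, h.add_right, h.smul_left, h.smul_right, bmX.ls_add,
      bmX.ls_smul, Finset.sum_add_distrib, Finset.smul_sum]

theorem isSesqui_interiorRs :
    IsSesqui (RingHom.id ℂ) (RingHom.id ℂ) (interiorRs hX hu (bmY := bmY)) := by
  have h := isSesqui_interiorMk hX hu (bmY := bmY)
  constructor <;> intros <;>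
    simp [interiorRs, h.add_right, h.smul_right, bmY.rs_add, bmY.rs_add',
      bmY.rs_smul, bmY.rs_smul', Finset.sum_add_distrib, Finset.smul_sum]

theorem isSesqui_interiorLinn :
    IsSesqui (RingHom.id ℂ) (starRingEnd ℂ) (interiorLinn (bmX := bmX) (bmY := bmY) (u := u)) := by
  constructor <;> intros <;>
    simp [interiorLinn, bmX.rs_add, bmX.rs_smul, bmX.linn_add_left, bmX.linn_smul_left,
      bmY.linn_add_left, bmY.linn_add_right, bmY.linn_smul_left, bmY.linn_smul_right,
      Finset.sum_add_distrib, Finset.smul_sum]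

theorem isSesqui_interiorRinn :
    IsSesqui (starRingEnd ℂ) (RingHom.id ℂ) (interiorRinn (bmX := bmX) (bmY := bmY) (u := u)) := by
  constructor <;> intros <;>
    simp [interiorRinn, bmY.rinn_add_left, bmY.rinn_add_right, bmY.rinn_smul_left,
      bmY.rinn_smul_right, Finset.sum_add_distrib, Finset.smul_sum]

theorem interiorLs_mk (a : A) (x : X) (y : Y) :
    interiorLs hX hu a (interiorMk hX hu bmY x y) = interiorMk hX hu bmY (bmX.ls a x) y := by
  change ∑ k, interiorMk hX hu bmY (bmX.ls a (u k)) (bmY.ls (bmX.rinn (u k) x) y) = _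
  simp only [← interiorMk_rs, ← bmX.ls_rs]
  rw [← (isSesqui_interiorMk hX hu).sum_left, ← bmX.isSesqui_ls.sum_right, hX.sum_rs_rinn hu]

theorem interiorRs_mk (x : X) (y : Y) (c : C) :
    interiorRs hX hu (interiorMk hX hu bmY x y) c = interiorMk hX hu bmY x (bmY.rs y c) := by
  change ∑ k, interiorMk hX hu bmY (u k) (bmY.rs (bmY.ls (bmX.rinn (u k) x) y) c) = _
  simp only [← bmY.ls_rs, ← interiorMk_rs]
  rw [← (isSesqui_interiorMk hX hu).sum_left, hX.sum_rs_rinn hu]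

theorem interiorLinn_mk (x x' : X) (y y' : Y) :
    interiorLinn (interiorMk hX hu bmY x y) (interiorMk hX hu bmY x' y')
      = bmX.linn (bmX.rs x (bmY.linn y y')) x' := by
  change ∑ k, ∑ l, bmX.linn (bmX.rs (u k) (bmY.linn (bmY.ls (bmX.rinn (u k) x) y)
    (bmY.ls (bmX.rinn (u l) x') y'))) (u l) = _
  simp only [bmY.linn_ls, bmY.linn_ls_right, ← mul_assoc]
  simp only [bmX.rs_mul, bmX.linn_rs _ _ (star _), star_star]
  rw [Finset.sum_comm]
  simp only [← bmX.isSesqui_linn.sum_left, ← bmX.isSesqui_rs.sum_left, hX.sum_rs_rinn hu,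
    ← bmX.isSesqui_linn.sum_right]

theorem interiorRinn_mk (x x' : X) (y y' : Y) :
    interiorRinn (interiorMk hX hu bmY x y) (interiorMk hX hu bmY x' y')
      = bmY.rinn y (bmY.ls (bmX.rinn x x') y') := by
  change ∑ k, bmY.rinn (bmY.ls (bmX.rinn (u k) x) y) (bmY.ls (bmX.rinn (u k) x') y') = _
  simp only [bmY.rinn_ls, bmX.rinn_star, ← bmY.ls_mul, ← bmX.rinn_rs]
  rw [← bmY.isSesqui_rinn.sum_right, ← bmY.isSesqui_ls.sum_left, ← bmX.isSesqui_rinn.sum_right,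
    hX.sum_rs_rinn hu]

theorem interiorLinn_pos (hY : bmY.IsEquivalence) (w : interior bmX bmY u) :
    ∃ a, interiorLinn w w = star a * a := by
  obtain ⟨m, v, hv⟩ := hY.exists_sum_rinn_eq_one
  have hw : interiorLinn w w = ∑ j,
      bmX.linn (∑ k, bmX.rs (u k) (bmY.linn (w.1 k) (v j)))
        (∑ k, bmX.rs (u k) (bmY.linn (w.1 k) (v j))) := by
    have hmul : ∀ k l, bmY.linn (w.1 k) (w.1 l)
        = ∑ j, bmY.linn (w.1 k) (v j) * bmY.linn (v j) (w.1 l) := fun k l => by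
      simp only [← bmY.linn_ls, ← bmY.isSesqui_linn.sum_left, hY.sum_ls_linn hv]
    have hrs : ∀ (x y : X) (b : B), bmX.linn x (bmX.rs y b) = bmX.linn (bmX.rs x (star b)) y :=
      fun x y b => by rw [bmX.linn_rs, star_star]
    simp only [interiorLinn, hmul, bmX.isSesqui_rs.sum_right, bmX.isSesqui_linn.sum_left,
      bmX.isSesqui_linn.sum_right, hrs, bmY.linn_star, ← bmX.rs_mul]
    simp only [Finset.sum_comm (s := (Finset.univ : Finset (Fin m)))]
  rw [hw]
  exact exists_sum_star_mul_self _ _ fun j _ => bmX.linn_pos _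

/-- The interior tensor product of two equivalence bimodules as a Hilbert bimodule. -/
def interiorBimod (hY : bmY.IsEquivalence) : Bimod A C (interior bmX bmY u) where
  ls := interiorLs hX hu
  rs := interiorRs hX hu
  linn := interiorLinn
  rinn := interiorRinn
  ls_one w := by
    simp only [interiorLs, bmX.ls_one, sum_interiorMk]
  ls_mul a a' w := by
    obtain ⟨y, rfl⟩ := exists_eq_sum_interiorMk hX hu w
    simp only [(isSesqui_interiorLs hX hu).sum_right, interiorLs_mk, bmX.ls_mul]
  ls_add := (isSesqui_interiorLs hX hu).add_left
  ls_add' := (isSesqui_interiorLs hX hu).add_right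
  ls_smul := (isSesqui_interiorLs hX hu).smul_left
  ls_smul' := (isSesqui_interiorLs hX hu).smul_right
  rs_one w := by
    simp only [interiorRs, bmY.rs_one, sum_interiorMk]
  rs_mul w c c' := by
    obtain ⟨y, rfl⟩ := exists_eq_sum_interiorMk hX hu w
    simp only [(isSesqui_interiorRs hX hu).sum_left, interiorRs_mk, bmY.rs_mul]
  rs_add := (isSesqui_interiorRs hX hu).add_right
  rs_add' w w' c := (isSesqui_interiorRs hX hu).add_left w w' c
  rs_smul := (isSesqui_interiorRs hX hu).smul_right
  rs_smul' := (isSesqui_interiorRs hX hu).smul_left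
  ls_rs a w c := by
    obtain ⟨y, rfl⟩ := exists_eq_sum_interiorMk hX hu w
    simp only [(isSesqui_interiorRs hX hu).sum_left, (isSesqui_interiorLs hX hu).sum_right,
      interiorRs_mk, interiorLs_mk]
  linn_add_left := isSesqui_interiorLinn.add_left
  linn_add_right := isSesqui_interiorLinn.add_right
  rinn_add_left := isSesqui_interiorRinn.add_left
  rinn_add_right := isSesqui_interiorRinn.add_right
  linn_smul_left := isSesqui_interiorLinn.smul_left
  linn_smul_right := isSesqui_interiorLinn.smul_right
  rinn_smul_left := isSesqui_interiorRinn.smul_left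
  rinn_smul_right := isSesqui_interiorRinn.smul_right
  linn_star w w' := by
    simp only [interiorLinn, star_sum, bmX.linn_star]
    rw [Finset.sum_comm]
    simp only [bmX.linn_rs, bmY.linn_star]
  rinn_star w w' := by
    simp only [interiorRinn, star_sum, bmY.rinn_star]
  linn_ls a w w' := by
    obtain ⟨y, rfl⟩ := exists_eq_sum_interiorMk hX hu w
    obtain ⟨y', rfl⟩ := exists_eq_sum_interiorMk hX hu w'
    simp only [(isSesqui_interiorLs hX hu).sum_right, isSesqui_interiorLinn.sum_left,
      isSesqui_interiorLinn.sum_right, interiorLs_mk, interiorLinn_mk, ← bmX.ls_rs, bmX.linn_ls,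
      Finset.mul_sum]
  rinn_rs w w' c := by
    obtain ⟨y, rfl⟩ := exists_eq_sum_interiorMk hX hu w
    obtain ⟨y', rfl⟩ := exists_eq_sum_interiorMk hX hu w'
    simp only [(isSesqui_interiorRs hX hu).sum_left, isSesqui_interiorRinn.sum_left,
      isSesqui_interiorRinn.sum_right, interiorRs_mk, interiorRinn_mk, bmY.ls_rs, bmY.rinn_rs,
      Finset.sum_mul]
  linn_rs w w' c := by
    obtain ⟨y, rfl⟩ := exists_eq_sum_interiorMk hX hu w
    obtain ⟨y', rfl⟩ := exists_eq_sum_interiorMk hX hu w'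
    simp only [(isSesqui_interiorRs hX hu).sum_left, isSesqui_interiorLinn.sum_left,
      isSesqui_interiorLinn.sum_right, interiorRs_mk, interiorLinn_mk, bmY.linn_rs]
  rinn_ls a w w' := by
    obtain ⟨y, rfl⟩ := exists_eq_sum_interiorMk hX hu w
    obtain ⟨y', rfl⟩ := exists_eq_sum_interiorMk hX hu w'
    simp only [(isSesqui_interiorLs hX hu).sum_right, isSesqui_interiorRinn.sum_left,
      isSesqui_interiorRinn.sum_right, interiorLs_mk, interiorRinn_mk, bmX.rinn_ls]
  linn_pos := interiorLinn_pos hY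
  rinn_pos w := exists_sum_star_mul_self _ _ fun k _ => bmY.rinn_pos _
  rinn_def w hw := by
    ext k
    exact bmY.rinn_def _
      (eq_zero_of_sum_eq_zero _ _ (fun k _ => bmY.rinn_pos _) hw k (Finset.mem_univ k))

theorem interiorBimod_isEquivalence (hY : bmY.IsEquivalence) :
    (interiorBimod hX hu hY).IsEquivalence := by
  refine ⟨fun w w' w'' => ?_, ?_, ?_⟩
  · obtain ⟨y, rfl⟩ := exists_eq_sum_interiorMk hX hu w
    obtain ⟨y', rfl⟩ := exists_eq_sum_interiorMk hX hu w'
    obtain ⟨y'', rfl⟩ := exists_eq_sum_interiorMk hX hu w''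
    have key : ∀ (x x' x'' : X) (y y' y'' : Y),
        interiorLs hX hu (bmX.linn (bmX.rs x (bmY.linn y y')) x') (interiorMk hX hu bmY x'' y'')
          = interiorRs hX hu (interiorMk hX hu bmY x y)
              (bmY.rinn y' (bmY.ls (bmX.rinn x' x'') y'')) := by
      intro x x' x'' y y' y''
      rw [interiorLs_mk, interiorRs_mk, hX.1, interiorMk_rs, interiorMk_rs, hY.1]
    simp only [interiorBimod, (isSesqui_interiorRs hX hu).sum_left,
      (isSesqui_interiorRs hX hu).sum_right, (isSesqui_interiorLs hX hu).sum_right,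
      (isSesqui_interiorLs hX hu).sum_left, isSesqui_interiorRinn.sum_left,
      isSesqui_interiorLinn.sum_left, isSesqui_interiorRinn.sum_right,
      isSesqui_interiorLinn.sum_right, interiorLinn_mk, interiorRinn_mk, key]
    rw [Finset.sum_comm]
    exact Finset.sum_congr rfl fun _ _ => Finset.sum_comm
  · have h : ∀ b ∈ Submodule.span ℂ (Set.range fun p : Y × Y => bmY.linn p.1 p.2), ∀ x x',
        bmX.linn (bmX.rs x b) x' ∈ Submodule.span ℂ (Set.range
          fun p : interior bmX bmY u × interior bmX bmY u => interiorLinn p.1 p.2) := by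
      intro b hb x x'
      induction hb using Submodule.span_induction with
      | mem b hb =>
        obtain ⟨p, rfl⟩ := hb
        exact Submodule.subset_span
          ⟨(interiorMk hX hu bmY x p.1, interiorMk hX hu bmY x' p.2), interiorLinn_mk hX hu x x' p.1 p.2⟩
      | zero => simp [bmX.isSesqui_rs.zero_right, bmX.isSesqui_linn.zero_left]
      | add b b' _ _ hb hb' =>
        rw [bmX.rs_add, bmX.linn_add_left]
        exact Submodule.add_mem _ hb hb'
      | smul c b _ hb =>
        rw [bmX.rs_smul, bmX.linn_smul_left]
        exact Submodule.smul_mem _ c hb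
    refine eq_top_iff.2 (hX.2.1 ▸ Submodule.span_le.2 ?_)
    rintro _ ⟨p, rfl⟩
    have hp := h 1 (hY.2.1 ▸ Submodule.mem_top) p.1 p.2
    rw [bmX.rs_one] at hp
    exact hp
  · have h : ∀ b ∈ Submodule.span ℂ (Set.range fun p : X × X => bmX.rinn p.1 p.2), ∀ y y',
        bmY.rinn y (bmY.ls b y') ∈ Submodule.span ℂ (Set.range
          fun p : interior bmX bmY u × interior bmX bmY u => interiorRinn p.1 p.2) := by
      intro b hb y y'
      induction hb using Submodule.span_induction with
      | mem b hb =>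
        obtain ⟨p, rfl⟩ := hb
        exact Submodule.subset_span
          ⟨(interiorMk hX hu bmY p.1 y, interiorMk hX hu bmY p.2 y'), interiorRinn_mk hX hu p.1 p.2 y y'⟩
      | zero => simp [bmY.isSesqui_ls.zero_left, bmY.isSesqui_rinn.zero_right]
      | add b b' _ _ hb hb' =>
        rw [bmY.ls_add, bmY.rinn_add_right]
        exact Submodule.add_mem _ hb hb'
      | smul c b _ hb =>
        rw [bmY.ls_smul, bmY.rinn_smul_right]
        exact Submodule.smul_mem _ c hb
    refine eq_top_iff.2 (hY.2.2 ▸ Submodule.span_le.2 ?_)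
    rintro _ ⟨p, rfl⟩
    have hp := h 1 (hX.2.2 ▸ Submodule.mem_top) p.1 p.2
    rw [bmY.ls_one] at hp
    exact hp

theorem span_interiorMk :
    Submodule.span ℂ (Set.range fun p : X × Y => interiorMk hX hu bmY p.1 p.2) = ⊤ := by
  refine eq_top_iff.2 fun w _ => ?_
  rw [← sum_interiorMk hX hu w]
  exact Submodule.sum_mem _ fun k _ => Submodule.subset_span ⟨(u k, w.1 k), rfl⟩

variable {H0 : Type u} [Ring H0] [Algebra ℂ H0] [StarRing H0] [StarModule ℂ H0]
  [FiniteDimensional ℂ H0]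

/-- The map on the interior tensor product induced by coactions on both factors. -/
def interiorCoact (lam : X →ₗ[ℂ] X ⊗[ℂ] H0) (mu : Y →ₗ[ℂ] Y ⊗[ℂ] H0) :
    interior bmX bmY u →ₗ[ℂ] interior bmX bmY u ⊗[ℂ] H0 where
  toFun w := ∑ k, tact (interiorMk hX hu bmY) (lam (u k)) (mu (w.1 k))
  map_add' w w' := by
    simp [tact, tmix_add_right (isSesqui_interiorMk hX hu), Finset.sum_add_distrib]
  map_smul' c w := by
    simp [tact, tmix_smul_right (isSesqui_interiorMk hX hu), Finset.smul_sum]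

variable {ε0 : H0 →ₗ[ℂ] ℂ} {ρ : A →ₗ[ℂ] A ⊗[ℂ] H0} {σ : B →ₗ[ℂ] B ⊗[ℂ] H0}
  {γ : C →ₗ[ℂ] C ⊗[ℂ] H0} {lam : X →ₗ[ℂ] X ⊗[ℂ] H0} {mu : Y →ₗ[ℂ] Y ⊗[ℂ] H0}

theorem interiorCoact_mk (hlam : IsWeakCoactionBimod ε0 bmX ρ σ lam)
    (hmu : IsWeakCoactionBimod ε0 bmY σ γ mu) (x : X) (y : Y) :
    interiorCoact hX hu lam mu (interiorMk hX hu bmY x y)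
      = tact (interiorMk hX hu bmY) (lam x) (mu y) := by
  have hθ := isSesqui_interiorMk hX hu (bmY := bmY)
  have key : ∀ (s : X ⊗[ℂ] H0) (t : B ⊗[ℂ] H0) (r : Y ⊗[ℂ] H0),
      tact (interiorMk hX hu bmY) (tact bmX.rs s t) r
        = tact (interiorMk hX hu bmY) s (tact bmY.ls t r) :=
    tmix_assoc bmX.isSesqui_rs hθ bmY.isSesqui_ls hθ isSesqui_mul isSesqui_mul isSesqui_mul
      isSesqui_mul (interiorMk_rs hX hu) mul_assoc
  change ∑ k, tact (interiorMk hX hu bmY) (lam (u k)) (mu (bmY.ls (bmX.rinn (u k) x) y)) = _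
  simp only [hmu.ls_compat, ← key, ← hlam.rs_compat]
  rw [tact, ← tmix_sum_left hθ, ← map_sum, hX.sum_rs_rinn hu]

theorem appRight_tact_interiorMk {ι : Type*} (I : Finset ι) {f : H0 →ₗ[ℂ] ℂ}
    {f₁ f₂ : ι → H0 →ₗ[ℂ] ℂ} (hf : ∀ g h, f (g * h) = ∑ i ∈ I, f₁ i g * f₂ i h)
    (s : X ⊗[ℂ] H0) (t : Y ⊗[ℂ] H0) :
    appRight f (tact (interiorMk hX hu bmY) s t)
      = ∑ i ∈ I, interiorMk hX hu bmY (appRight (f₁ i) s) (appRight (f₂ i) t) := by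
  have hθ := isSesqui_interiorMk hX hu (bmY := bmY)
  rw [tact]
  induction s with
  | zero => simp only [tmix_zero_left hθ, map_zero, hθ.zero_left, Finset.sum_const_zero]
  | add s s' hs hs' =>
    simp only [tmix_add_left hθ, map_add, hθ.add_left, hs, hs', Finset.sum_add_distrib]
  | tmul x g =>
    induction t with
    | zero => simp only [tmix_zero_right hθ, map_zero, hθ.zero_right, Finset.sum_const_zero]
    | add t t' ht ht' =>
      simp only [tmix_add_right hθ, map_add, hθ.add_right, ht, ht', Finset.sum_add_distrib]
    | tmul y h =>
      simp only [tmix_tmul hθ isSesqui_mul, appRight_tmul, hf, hθ.smul_left, hθ.smul_right,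
        Finset.sum_smul, mul_smul, RingHom.id_apply]

theorem interiorCoact_isWeakCoactionBimod (hε : ∀ g h, ε0 (g * h) = ε0 g * ε0 h)
    (hY : bmY.IsEquivalence) (hlam : IsWeakCoactionBimod ε0 bmX ρ σ lam)
    (hmu : IsWeakCoactionBimod ε0 bmY σ γ mu) :
    IsWeakCoactionBimod ε0 (interiorBimod hX hu hY) ρ γ (interiorCoact hX hu lam mu) := by
  have hθ := isSesqui_interiorMk hX hu (bmY := bmY)
  have hls := isSesqui_interiorLs hX hu (bmY := bmY)
  have hrs := isSesqui_interiorRs hX hu (bmY := bmY)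
  have hlinn := isSesqui_interiorLinn (bmX := bmX) (bmY := bmY) (u := u)
  have hrinn := isSesqui_interiorRinn (bmX := bmX) (bmY := bmY) (u := u)
  refine ⟨fun a w => ?_, fun w c => ?_, fun w w' => ?_, fun w w' => ?_, fun w => ?_⟩
  · obtain ⟨y, rfl⟩ := exists_eq_sum_interiorMk hX hu w
    simp only [interiorBimod, tact, hls.sum_right, map_sum, tmix_sum_right hls]
    refine Finset.sum_congr rfl fun k _ => ?_
    rw [interiorLs_mk, interiorCoact_mk hX hu hlam hmu, interiorCoact_mk hX hu hlam hmu,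
      hlam.ls_compat]
    exact tmix_assoc bmX.isSesqui_ls hθ hθ hls isSesqui_mul isSesqui_mul isSesqui_mul
      isSesqui_mul (fun a x y => (interiorLs_mk hX hu a x y).symm) mul_assoc _ _ _
  · obtain ⟨y, rfl⟩ := exists_eq_sum_interiorMk hX hu w
    simp only [interiorBimod, tact, hrs.sum_left, map_sum, tmix_sum_left hrs]
    refine Finset.sum_congr rfl fun k _ => ?_
    rw [interiorRs_mk, interiorCoact_mk hX hu hlam hmu, interiorCoact_mk hX hu hlam hmu,
      hmu.rs_compat]
    exact (tmix_assoc hθ hrs bmY.isSesqui_rs hθ isSesqui_mul isSesqui_mul isSesqui_mul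
      isSesqui_mul (interiorRs_mk hX hu) mul_assoc _ _ _).symm
  · obtain ⟨y, rfl⟩ := exists_eq_sum_interiorMk hX hu w
    obtain ⟨y', rfl⟩ := exists_eq_sum_interiorMk hX hu w'
    simp only [interiorBimod, tinnL, hlinn.sum_left, hlinn.sum_right, map_sum,
      tmix_sum_left hlinn, tmix_sum_right hlinn]
    refine Finset.sum_congr rfl fun k _ => Finset.sum_congr rfl fun l _ => ?_
    rw [interiorLinn_mk, interiorCoact_mk hX hu hlam hmu, interiorCoact_mk hX hu hlam hmu,
      hlam.linn_compat, hlam.rs_compat, hmu.linn_compat, tinnL, tinnL, tact, tact]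
    generalize lam (u k) = a
    generalize lam (u l) = b
    generalize mu (y k) = c
    generalize mu (y' l) = d
    have h1 := bmX.isSesqui_linn
    have h2 := bmX.isSesqui_rs
    have h3 := bmY.isSesqui_linn
    induction a with
    | zero => simp only [tmix_zero_left h1, tmix_zero_left h2, tmix_zero_left hθ,
        tmix_zero_left hlinn]
    | add a a' ha ha' => simp only [tmix_add_left h1, tmix_add_left h2, tmix_add_left hθ,
        tmix_add_left hlinn, ha, ha']
    | tmul a g =>
    induction b with
    | zero => simp only [tmix_zero_right h1, tmix_zero_left hθ, tmix_zero_right hlinn]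
    | add b b' hb hb' => simp only [tmix_add_right h1, tmix_add_left hθ, tmix_add_right hlinn,
        hb, hb']
    | tmul b h =>
    induction c with
    | zero => simp only [tmix_zero_left h1, tmix_zero_right h2, tmix_zero_left h3,
        tmix_zero_right hθ, tmix_zero_left hlinn]
    | add c c' hc hc' => simp only [tmix_add_left h1, tmix_add_right h2, tmix_add_left h3,
        tmix_add_right hθ, tmix_add_left hlinn, hc, hc']
    | tmul c i =>
    induction d with
    | zero => simp only [tmix_zero_left h1, tmix_zero_right h2, tmix_zero_right h3,
        tmix_zero_right hθ, tmix_zero_right hlinn]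
    | add d d' hd hd' => simp only [tmix_add_left h1, tmix_add_right h2, tmix_add_right h3,
        tmix_add_right hθ, tmix_add_right hlinn, hd, hd']
    | tmul d j =>
      simp only [tmix_tmul h1 isSesqui_mul_star, tmix_tmul h2 isSesqui_mul,
        tmix_tmul h3 isSesqui_mul_star, tmix_tmul hθ isSesqui_mul,
        tmix_tmul hlinn isSesqui_mul_star, interiorLinn_mk, star_mul, mul_assoc]
  · obtain ⟨y, rfl⟩ := exists_eq_sum_interiorMk hX hu w
    obtain ⟨y', rfl⟩ := exists_eq_sum_interiorMk hX hu w'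
    simp only [interiorBimod, tinnR, hrinn.sum_left, hrinn.sum_right, map_sum,
      tmix_sum_left hrinn, tmix_sum_right hrinn]
    refine Finset.sum_congr rfl fun k _ => Finset.sum_congr rfl fun l _ => ?_
    rw [interiorRinn_mk, interiorCoact_mk hX hu hlam hmu, interiorCoact_mk hX hu hlam hmu,
      hmu.rinn_compat, hmu.ls_compat, hlam.rinn_compat, tinnR, tinnR, tact, tact]
    generalize lam (u k) = a
    generalize lam (u l) = b
    generalize mu (y k) = c
    generalize mu (y' l) = d
    have h1 := bmY.isSesqui_rinn
    have h2 := bmY.isSesqui_ls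
    have h3 := bmX.isSesqui_rinn
    induction a with
    | zero => simp only [tmix_zero_right h1, tmix_zero_left h2, tmix_zero_left h3,
        tmix_zero_left hθ, tmix_zero_left hrinn]
    | add a a' ha ha' => simp only [tmix_add_right h1, tmix_add_left h2, tmix_add_left h3,
        tmix_add_left hθ, tmix_add_left hrinn, ha, ha']
    | tmul a g =>
    induction b with
    | zero => simp only [tmix_zero_right h1, tmix_zero_left h2, tmix_zero_right h3,
        tmix_zero_left hθ, tmix_zero_right hrinn]
    | add b b' hb hb' => simp only [tmix_add_right h1, tmix_add_left h2, tmix_add_right h3,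
        tmix_add_left hθ, tmix_add_right hrinn, hb, hb']
    | tmul b h =>
    induction c with
    | zero => simp only [tmix_zero_left h1, tmix_zero_right hθ, tmix_zero_left hrinn]
    | add c c' hc hc' => simp only [tmix_add_left h1, tmix_add_right hθ, tmix_add_left hrinn,
        hc, hc']
    | tmul c i =>
    induction d with
    | zero => simp only [tmix_zero_right h1, tmix_zero_right h2,
        tmix_zero_right hθ, tmix_zero_right hrinn]
    | add d d' hd hd' => simp only [tmix_add_right h1, tmix_add_right h2,
        tmix_add_right hθ, tmix_add_right hrinn, hd, hd']
    | tmul d j =>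
      simp only [tmix_tmul h1 isSesqui_star_mul, tmix_tmul h2 isSesqui_mul,
        tmix_tmul h3 isSesqui_star_mul, tmix_tmul hθ isSesqui_mul,
        tmix_tmul hrinn isSesqui_star_mul, interiorRinn_mk, star_mul, mul_assoc]
  · obtain ⟨y, rfl⟩ := exists_eq_sum_interiorMk hX hu w
    simp only [map_sum]
    refine Finset.sum_congr rfl fun k _ => ?_
    rw [interiorCoact_mk hX hu hlam hmu, appRight_tact_interiorMk hX hu {()}
      (f₁ := fun _ => ε0) (f₂ := fun _ => ε0) (by simpa using hε), Finset.sum_singleton,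
      hlam.counital, hmu.counital]

end Interior

/-- Strong Morita equivalence of weak coactions of `H0` on unital
C*-algebras is an equivalence relation (on the class of C*-algebras equipped with weak
coactions); in particular, in the transitivity situation, if `ρ ∼ σ` via `(X, λ)` and
`σ ∼ γ` via `(Y, μ)`, then there is a weak coaction `ν` of `H0` on the interior tensor
product `Z = X ⊗_B Y` (presented by a balanced surjective bilinear map `θ : X × Y → Z`
with the canonical induced equivalence-bimodule structure) satisfying
`h ·_ν θ(x,y) = Σ θ(h₍₁₎ ·_λ x, h₍₂₎ ·_μ y)`, and `ν` implements a strong Morita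
equivalence between `ρ` and `γ`. -/
theorem weakSME_equivalence_relation
    {H H0 : Type u} [CStarAlgebra H] [StarModule ℂ H] [FiniteDimensional ℂ H]
    [CStarAlgebra H0] [StarModule ℂ H0] [FiniteDimensional ℂ H0]
    (dp : HopfPairData H H0) :
    -- the relation is an equivalence relation
    ((∀ P : CoactedCStar.{u} H0, IsWeakCoaction dp.dH0.counit.toLinearMap P.coact →
        WeakSME dp.dH0.counit.toLinearMap P.coact P.coact) ∧
     (∀ P Q : CoactedCStar.{u} H0,
        IsWeakCoaction dp.dH0.counit.toLinearMap P.coact →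
        IsWeakCoaction dp.dH0.counit.toLinearMap Q.coact →
        WeakSME dp.dH0.counit.toLinearMap P.coact Q.coact →
        WeakSME dp.dH0.counit.toLinearMap Q.coact P.coact) ∧
     (∀ P Q R : CoactedCStar.{u} H0,
        IsWeakCoaction dp.dH0.counit.toLinearMap P.coact →
        IsWeakCoaction dp.dH0.counit.toLinearMap Q.coact →
        IsWeakCoaction dp.dH0.counit.toLinearMap R.coact →
        WeakSME dp.dH0.counit.toLinearMap P.coact Q.coact →
        WeakSME dp.dH0.counit.toLinearMap Q.coact R.coact →
        WeakSME dp.dH0.counit.toLinearMap P.coact R.coact)) ∧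
    -- transitivity via the interior tensor product `X ⊗_B Y`
    (∀ (A B C : Type u) (_ : CStarAlgebra A) (_ : StarModule ℂ A)
        (_ : CStarAlgebra B) (_ : StarModule ℂ B) (_ : CStarAlgebra C) (_ : StarModule ℂ C)
        (ρ : A →ₗ[ℂ] A ⊗[ℂ] H0) (σ : B →ₗ[ℂ] B ⊗[ℂ] H0) (γ : C →ₗ[ℂ] C ⊗[ℂ] H0)
        (_ : IsWeakCoaction dp.dH0.counit.toLinearMap ρ)
        (_ : IsWeakCoaction dp.dH0.counit.toLinearMap σ)
        (_ : IsWeakCoaction dp.dH0.counit.toLinearMap γ)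
        (X Y : Type u) (_ : AddCommGroup X) (_ : Module ℂ X)
        (_ : AddCommGroup Y) (_ : Module ℂ Y)
        (bmX : Bimod A B X) (bmY : Bimod B C Y)
        (_ : bmX.IsEquivalence) (_ : bmY.IsEquivalence)
        (lam : X →ₗ[ℂ] X ⊗[ℂ] H0) (mu : Y →ₗ[ℂ] Y ⊗[ℂ] H0)
        (_ : IsWeakCoactionBimod dp.dH0.counit.toLinearMap bmX ρ σ lam)
        (_ : IsWeakCoactionBimod dp.dH0.counit.toLinearMap bmY σ γ mu),
      ∃ (Z : Type u) (_ : AddCommGroup Z) (_ : Module ℂ Z) (bmZ : Bimod A C Z)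
        (θ : X → Y → Z) (ν : Z →ₗ[ℂ] Z ⊗[ℂ] H0),
        bmZ.IsEquivalence ∧
        -- `θ` exhibits `Z` as the interior tensor product `X ⊗_B Y`
        (∀ x x' y, θ (x + x') y = θ x y + θ x' y) ∧
        (∀ x y y', θ x (y + y') = θ x y + θ x y') ∧
        (∀ (c : ℂ) x y, θ (c • x) y = c • θ x y) ∧
        (∀ (c : ℂ) x y, θ x (c • y) = c • θ x y) ∧
        (∀ x b y, θ (bmX.rs x b) y = θ x (bmY.ls b y)) ∧
        (∀ a x y, bmZ.ls a (θ x y) = θ (bmX.ls a x) y) ∧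
        (∀ x y c, bmZ.rs (θ x y) c = θ x (bmY.rs y c)) ∧
        (∀ x y x' y', bmZ.linn (θ x y) (θ x' y')
            = bmX.linn (bmX.rs x (bmY.linn y y')) x') ∧
        (∀ x y x' y', bmZ.rinn (θ x y) (θ x' y')
            = bmY.rinn y (bmY.ls (bmX.rinn x x') y')) ∧
        Submodule.span ℂ (Set.range fun p : X × Y => θ p.1 p.2) = ⊤ ∧
        -- `ν` is a weak coaction with respect to `(A, C, ρ, γ)` ...
        IsWeakCoactionBimod dp.dH0.counit.toLinearMap bmZ ρ γ ν ∧
        -- ... acting by `h ·_ν (x ⊗ y) = [h₍₁₎ ·_λ x] ⊗ [h₍₂₎ ·_μ y]`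
        (∀ (h : H) (x : X) (y : Y) (n : ℕ) (h1 h2 : Fin n → H),
          dp.dH.comul h = ∑ i, h1 i ⊗ₜ h2 i →
          coactAct dp ν h (θ x y)
            = ∑ i, θ (coactAct dp lam (h1 i) x) (coactAct dp mu (h2 i) y))) := by
  have hmul : ∀ g h, dp.dH0.counit.toLinearMap (g * h)
      = dp.dH0.counit.toLinearMap g * dp.dH0.counit.toLinearMap h := map_mul dp.dH0.counit
  refine ⟨⟨fun P hP => ⟨P.carrier, _, _, idBimod P.carrier, idBimod_isEquivalence _, P.coact,
      idBimod_isWeakCoactionBimod hP⟩, ?_, ?_⟩, ?_⟩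
  · rintro P Q hP hQ ⟨X, _, _, bm, hbm, lam, hlam⟩
    exact ⟨Conj X, _, _, bm.conj hbm, bm.conj_isEquivalence hbm, conjCoact lam,
      conjCoact_isWeakCoactionBimod dp.dH0.counit_star hbm hP hQ hlam⟩
  · rintro P Q R - - - ⟨X, _, _, bmX, hX, lam, hlam⟩ ⟨Y, _, _, bmY, hY, mu, hmu⟩
    obtain ⟨n, u, hu⟩ := hX.exists_sum_linn_eq_one
    exact ⟨interior bmX bmY u, _, _, interiorBimod hX hu hY, interiorBimod_isEquivalence hX hu hY,
      interiorCoact hX hu lam mu, interiorCoact_isWeakCoactionBimod hX hu hmul hY hlam hmu⟩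
  · intro A B C _ _ _ _ _ _ ρ σ γ _ _ _ X Y _ _ _ _ bmX bmY hX hY lam mu hlam hmu
    obtain ⟨n, u, hu⟩ := hX.exists_sum_linn_eq_one
    have hθ := isSesqui_interiorMk hX hu (bmY := bmY)
    refine ⟨interior bmX bmY u, _, _, interiorBimod hX hu hY, interiorMk hX hu bmY,
      interiorCoact hX hu lam mu, interiorBimod_isEquivalence hX hu hY, hθ.add_left, hθ.add_right,
      hθ.smul_left, hθ.smul_right, interiorMk_rs hX hu, interiorLs_mk hX hu, interiorRs_mk hX hu,
      fun x y x' y' => interiorLinn_mk hX hu x x' y y',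
      fun x y x' y' => interiorRinn_mk hX hu x x' y y', span_interiorMk hX hu,
      interiorCoact_isWeakCoactionBimod hX hu hmul hY hlam hmu, ?_⟩
    intro h x y m h1 h2 hh
    rw [coactAct, interiorCoact_mk hX hu hlam hmu]
    exact appRight_tact_interiorMk hX hu Finset.univ
      (fun φ ψ => dp.pair_mul_right h φ ψ m h1 h2 hh) _ _

end SMEPaper
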